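/- arXiv:1011.1557 — 2 statements merged into one kernel-verified Lean document; each statement's English description precedes it below -/
import Mathlib

section
/- The chain varieties of commutative semigroups are exactly the following: the varieties A_{p^k} with p prime and k a natural number, SL, the varieties N_k for natural k, N_ω, and N_3^c. -/
open FirstOrder

/-! ### Words, identities, and commutative semigroup varieties -/

/-- Semigroup words over the countable alphabet `ℕ`. -/
abbrev SGWord : Type := FreeSemigroup ℕ

/-- A semigroup identity `u = v` is a pair of words. -/
abbrev SGId : Type := SGWord × SGWord

/-- The one-letter word consisting of the letter `n`. -/
def ltr (n : ℕ) : SGWord := FreeSemigroup.of n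

/-- `wpow w n` is the word `w^n` (for `n ≥ 1`; by convention `wpow w 0 = w`). -/
def wpow (w : SGWord) : ℕ → SGWord
  | 0 => w
  | 1 => w
  | n + 2 => wpow w (n + 1) * w

/-- The letter `n` occurs in the word `w`. -/
def OccursIn (n : ℕ) (w : SGWord) : Prop := n = w.head ∨ n ∈ w.tail

/-- A semigroup `S` satisfies the identity `i.1 = i.2` if all evaluations of the two
words in `S` coincide. -/
def SGSatisfies (S : Type) [Semigroup S] (i : SGId) : Prop :=
  ∀ f : ℕ → S, FreeSemigroup.lift f i.1 = FreeSemigroup.lift f i.2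

/-- A bundled (nonempty) commutative semigroup. -/
structure ComSG where
  carrier : Type
  [str : CommSemigroup carrier]
  [instNonempty : Nonempty carrier]

attribute [instance] ComSG.str ComSG.instNonempty

/-- The class of commutative semigroups satisfying every identity in `E`. -/
def modelsOf (E : Set SGId) : Set ComSG := {S | ∀ i ∈ E, SGSatisfies S.carrier i}

/-- The set of identities holding in every member of the class `K`. -/
def theoryOfClass (K : Set ComSG) : Set SGId := {i | ∀ S ∈ K, SGSatisfies S.carrier i}

theorem subset_theoryOfClass_modelsOf (E : Set SGId) : E ⊆ theoryOfClass (modelsOf E) :=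
  fun i hi S hS => hS i hi

theorem theoryOfClass_antitone {K K' : Set ComSG} (h : K ⊆ K') :
    theoryOfClass K' ⊆ theoryOfClass K := fun _ hi S hS => hi S (h hS)

theorem modelsOf_antitone {E E' : Set SGId} (h : E ⊆ E') : modelsOf E' ⊆ modelsOf E :=
  fun _ hS i hi => hS i (h hi)

/-- A variety of commutative semigroups, identified with its (equationally closed)
equational theory.  Varieties are ordered by inclusion of the corresponding classes
of semigroups, i.e. by *reverse* inclusion of theories. -/
structure ComVariety where
  theory : Set SGId
  closed : theoryOfClass (modelsOf theory) = theory

theorem ComVariety.ext' {V W : ComVariety} (h : V.theory = W.theory) : V = W := by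
  cases V; cases W; cases h; rfl

instance : PartialOrder ComVariety where
  le V W := W.theory ⊆ V.theory
  le_refl V := subset_rfl
  le_trans U V W h1 h2 := fun i hi => h1 (h2 hi)
  le_antisymm V W h1 h2 := ComVariety.ext' (subset_antisymm h2 h1)

instance : SupSet ComVariety where
  sSup s :=
    { theory := ⋂ V ∈ s, V.theory
      closed := by
        apply subset_antisymm
        · intro i hi
          refine Set.mem_iInter₂.2 fun V hV => ?_
          have h1 : (⋂ V ∈ s, ComVariety.theory V) ⊆ V.theory := Set.biInter_subset_of_mem hV
          have h2 := theoryOfClass_antitone (modelsOf_antitone h1)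
          rw [V.closed] at h2
          exact h2 hi
        · exact subset_theoryOfClass_modelsOf _ }

/-- The lattice **Com** of all commutative semigroup varieties. -/
instance : CompleteLattice ComVariety :=
  completeLatticeOfSup ComVariety fun s => by
    constructor
    · intro V hV i hi
      exact Set.mem_iInter₂.1 hi V hV
    · intro W hW i hi
      exact Set.mem_iInter₂.2 fun V hV => hW hV hi

/-- The variety of commutative semigroups given by the identity system `E`. -/
def comVar (E : Set SGId) : ComVariety where
  theory := theoryOfClass (modelsOf E)
  closed := by
    apply subset_antisymm
    · exact theoryOfClass_antitone fun S hS i hi => hi S hS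
    · exact subset_theoryOfClass_modelsOf _

/-! ### The first-order language of lattices and definability -/

/-- The first-order language of lattices: two binary function symbols (`true` for the
join `∨` and `false` for the meet `∧`) and nothing else. -/
def latticeLang : Language where
  Functions := fun n => match n with | 2 => Bool | _ => Empty
  Relations := fun _ => Empty

instance latticeLangStructure (L : Type*) [Lattice L] : latticeLang.Structure L where
  funMap {n} f x :=
    match n, f with
    | 2, b => bif b then x 0 ⊔ x 1 else x 0 ⊓ x 1
    | 0, f => f.elim
    | 1, f => f.elim
    | (_ + 3), f => f.elim
  RelMap {n} r _ := r.elim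

/-- A subset `A` of a lattice `L` is definable in `L` if there is a first-order formula
`φ(x)` with one free variable in the language of the lattice operations `∨` and `∧`
such that for every `a ∈ L`, `φ(a)` holds in `L` if and only if `a ∈ A`. -/
def LatDefinable (L : Type*) [Lattice L] (A : Set L) : Prop :=
  ∃ φ : latticeLang.Formula (Fin 1), ∀ a : L, (φ.Realize fun _ => a) ↔ a ∈ A

/-! ### Named varieties -/

/-- The commutativity identity `xy = yx`. -/
def commId : SGId := (ltr 0 * ltr 1, ltr 1 * ltr 0)

/-- The pair of identities abbreviated by the symbolic identity `w = 0`, namely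
`wx = w` and `xw = w`, where `x` is the letter `n` (assumed not to occur in `w`). -/
def zeroId (w : SGWord) (n : ℕ) : Set SGId := {(w * ltr n, w), (ltr n * w, w)}

/-- `A n = var{xⁿy = y, xy = yx}`, the variety of Abelian groups of exponent dividing `n`. -/
def Avar (n : ℕ) : ComVariety := comVar {(wpow (ltr 0) n * ltr 1, ltr 1), commId}

/-- `SL = var{x² = x, xy = yx}`, the variety of semilattices. -/
def SLvar : ComVariety := comVar {(wpow (ltr 0) 2, ltr 0), commId}

/-- `ZM = var{xy = 0}` (within **Com**), the variety of null semigroups. -/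
def ZMvar : ComVariety := comVar ({commId} ∪ zeroId (ltr 0 * ltr 1) 2)

/-- `T = var{x = y}`, the trivial variety. -/
def Tvar : ComVariety := comVar {(ltr 0, ltr 1)}

/-- `COM`, the variety of all commutative semigroups. -/
def COMvar : ComVariety := comVar {commId}

/-- `C m = var{xᵐ = xᵐ⁺¹, xy = yx}` (the variety generated by the cyclic monoid
`⟨a ∣ aᵐ = aᵐ⁺¹⟩`), with the convention `C 0 = T`. -/
def Cvar : ℕ → ComVariety
  | 0 => Tvar
  | m + 1 => comVar {(wpow (ltr 0) (m + 1), wpow (ltr 0) (m + 2)), commId}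

/-- `D m = var{xᵐ = 0, xy = yx}`. -/
def Dvar (m : ℕ) : ComVariety := comVar ({commId} ∪ zeroId (wpow (ltr 0) m) 1)

/-- The word `x₁x₂⋯x_k` (in the letters `0, 1, …, k-1`), for `k ≥ 1`. -/
def chainWord : ℕ → SGWord
  | 0 => ltr 0
  | 1 => ltr 0
  | k + 2 => chainWord (k + 1) * ltr (k + 1)

/-- `N k = var{x² = x₁x₂⋯x_k = 0, xy = yx}`. -/
def Nvar (k : ℕ) : ComVariety :=
  comVar ({commId} ∪ zeroId (wpow (ltr 0) 2) 1 ∪ zeroId (chainWord k) k)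

/-- `N_ω = var{x² = 0, xy = yx}`. -/
def Nomegavar : ComVariety := comVar ({commId} ∪ zeroId (wpow (ltr 0) 2) 1)

/-- `N₃ᶜ = var{xyz = 0, xy = yx}`. -/
def N3cvar : ComVariety := comVar ({commId} ∪ zeroId (ltr 0 * ltr 1 * ltr 2) 3)

/-! ### Semantic notions -/

/-- A semigroup `S` belongs to the variety `V` if it satisfies every identity of `V`. -/
def VMem (S : Type) [Semigroup S] (V : ComVariety) : Prop :=
  ∀ i ∈ V.theory, SGSatisfies S i

/-- `spow a n` is the power `aⁿ` in a semigroup (for `n ≥ 1`; by convention `spow a 0 = a`). -/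
def spow {S : Type} [Semigroup S] (a : S) : ℕ → S
  | 0 => a
  | 1 => a
  | n + 2 => spow a (n + 1) * a

/-- A semigroup is a group. -/
def IsGroupSG (S : Type) [Semigroup S] : Prop :=
  ∃ e : S, (∀ a, e * a = a ∧ a * e = a) ∧ ∀ a, ∃ b, a * b = e ∧ b * a = e

/-- A semigroup is periodic: every element generates a finite cyclic subsemigroup. -/
def IsPeriodicSG (S : Type) [Semigroup S] : Prop :=
  ∀ a : S, ∃ i j : ℕ, 1 ≤ i ∧ i < j ∧ spow a i = spow a j

/-- A semigroup is a nil-semigroup: it has a zero element and every element has a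
power equal to zero. -/
def IsNilSG (S : Type) [Semigroup S] : Prop :=
  ∃ z : S, (∀ a, z * a = z ∧ a * z = z) ∧ ∀ a, ∃ n, 1 ≤ n ∧ spow a n = z

/-- A variety all of whose members are groups. -/
def IsGroupVariety (V : ComVariety) : Prop := ∀ S ∈ modelsOf V.theory, IsGroupSG S.carrier

/-- A variety all of whose members are periodic semigroups. -/
def IsPeriodicVariety (V : ComVariety) : Prop := ∀ S ∈ modelsOf V.theory, IsPeriodicSG S.carrier

/-- A nil-variety: a variety all of whose members are nil-semigroups. -/
def IsNilVariety (V : ComVariety) : Prop := ∀ S ∈ modelsOf V.theory, IsNilSG S.carrier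

/-- A combinatorial variety: all groups in it are trivial. -/
def IsCombinatorial (V : ComVariety) : Prop :=
  ∀ S ∈ modelsOf V.theory, IsGroupSG S.carrier → ∀ a b : S.carrier, a = b

/-- `K` is the variety generated by the semigroup `M` (with explicit semigroup
structure `inst`): the smallest variety containing `M`. -/
def GeneratedBy (M : Type) (inst : Semigroup M) (K : ComVariety) : Prop :=
  IsLeast {W : ComVariety | ∀ i ∈ W.theory, @SGSatisfies M inst i} K

/-- A neutral element of a lattice. -/
def IsNeutralElt {α : Type*} [Lattice α] (x : α) : Prop :=
  ∀ y z, (x ⊔ y) ⊓ (y ⊔ z) ⊓ (z ⊔ x) = (x ⊓ y) ⊔ (y ⊓ z) ⊔ (z ⊓ x)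

/-- A chain variety: a variety whose lattice of subvarieties is a chain. -/
def IsChainVariety (V : ComVariety) : Prop :=
  ∀ W₁ W₂ : ComVariety, W₁ ≤ V → W₂ ≤ V → W₁ ≤ W₂ ∨ W₂ ≤ W₁

/-- A variety is 0-reduced in **Com** if it is given within `COM` by 0-reduced
identities (identities of the form `w = 0`) only. -/
def IsZeroReduced (V : ComVariety) : Prop :=
  ∃ P : Set (SGWord × ℕ), (∀ p ∈ P, ¬ OccursIn p.2 p.1) ∧
    V = comVar (⋃ p ∈ P, zeroId p.1 p.2)

/-- `ZR V`: the least variety 0-reduced in **Com** that contains `V`. -/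
def ZRv (V : ComVariety) : ComVariety := sInf {W : ComVariety | IsZeroReduced W ∧ V ≤ W}


/-! ### Words as multisets of letters -/

/-- The multiset of letters of a word. -/
def SGWord.letters (w : SGWord) : Multiset ℕ := w.head ::ₘ (w.tail : Multiset ℕ)

namespace SGWord

@[simp] theorem letters_ltr (n : ℕ) : letters (ltr n) = {n} := rfl

@[simp] theorem letters_mul (u v : SGWord) : letters (u * v) = letters u + letters v := by
  simp [letters, FreeSemigroup.head_mul, FreeSemigroup.tail_mul, ← Multiset.coe_add,
    ← Multiset.cons_coe, Multiset.cons_swap]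

theorem card_letters_pos (w : SGWord) : 0 < w.letters.card := by simp [letters]

theorem letters_wpow (w : SGWord) {n : ℕ} (hn : 1 ≤ n) : letters (wpow w n) = n • letters w := by
  induction n, hn using Nat.le_induction with
  | base => simp [wpow]
  | succ n hn ih =>
    obtain ⟨m, rfl⟩ := Nat.exists_eq_add_of_le' hn
    rw [wpow, letters_mul, ih, succ_nsmul _ (m + 1)]

theorem letters_chainWord {k : ℕ} (hk : 1 ≤ k) : letters (chainWord k) = Multiset.range k := by
  induction k, hk using Nat.le_induction with
  | base => rfl
  | succ n hn ih =>
    obtain ⟨m, rfl⟩ := Nat.exists_eq_add_of_le' hn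
    rw [chainWord, letters_mul, ih, Multiset.range_succ (m + 1), letters_ltr, add_comm,
      Multiset.singleton_add]

theorem lift_eq_prod {M : Type} [CommMonoid M] (f : ℕ → M) (w : SGWord) :
    FreeSemigroup.lift f w = (w.letters.map f).prod := by
  induction w using FreeSemigroup.recOnMul with
  | ih1 n => change _ = ((letters (ltr n)).map f).prod; simp
  | ih2 n w h1 h2 => rw [letters_mul, map_mul, h1, h2, Multiset.map_add, Multiset.prod_add]

end SGWord

open SGWord

/-! ### Evaluation of words in the monoid obtained by adjoining an identity -/

/-- The value of a word in a semigroup `S`, viewed in `S` with an identity adjoined. -/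
def evalOne {S : Type} [CommSemigroup S] (f : ℕ → S) (w : SGWord) : WithOne S :=
  (FreeSemigroup.lift f w : S)

section Eval

variable {S : Type} [CommSemigroup S]

theorem evalOne_eq_prod (f : ℕ → S) (w : SGWord) :
    evalOne f w = (w.letters.map fun n => (f n : WithOne S)).prod := by
  rw [← lift_eq_prod (fun n => (f n : WithOne S))]
  induction w using FreeSemigroup.recOnMul with
  | ih1 n => simp [evalOne]
  | ih2 n w h1 h2 => simp only [evalOne, map_mul, WithOne.coe_mul] at *; rw [h1, h2]

@[simp] theorem evalOne_ltr (f : ℕ → S) (n : ℕ) : evalOne f (ltr n) = f n := by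
  simp [evalOne_eq_prod]

@[simp] theorem evalOne_mul (f : ℕ → S) (u v : SGWord) :
    evalOne f (u * v) = evalOne f u * evalOne f v := by
  simp [evalOne_eq_prod]

theorem evalOne_wpow (f : ℕ → S) (w : SGWord) {n : ℕ} (hn : 1 ≤ n) :
    evalOne f (wpow w n) = evalOne f w ^ n := by
  simp [evalOne_eq_prod, letters_wpow w hn, Multiset.map_nsmul, Multiset.prod_nsmul]

theorem evalOne_congr (f : ℕ → S) {u v : SGWord} (h : u.letters = v.letters) :
    evalOne f u = evalOne f v := by
  rw [evalOne_eq_prod, evalOne_eq_prod, h]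

theorem exists_coe_evalOne (f : ℕ → S) (w : SGWord) : ∃ a : S, evalOne f w = a := ⟨_, rfl⟩

theorem satisfies_iff (u v : SGWord) :
    SGSatisfies S (u, v) ↔ ∀ f : ℕ → S, evalOne f u = evalOne f v := by
  simp [SGSatisfies, evalOne]

theorem evalOne_const (a : S) (w : SGWord) :
    evalOne (fun _ => a) w = (a : WithOne S) ^ w.letters.card := by
  simp [evalOne_eq_prod]

theorem prod_map_ite {M : Type*} [CommMonoid M] (a b : M) (x : ℕ) (m : Multiset ℕ) :
    (m.map fun n => if n = x then a else b).prod =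
      a ^ m.count x * b ^ (m.card - m.count x) := by
  induction m using Multiset.induction with
  | empty => simp
  | cons n m ih =>
    have := m.count_le_card x
    by_cases h : n = x
    · subst h
      simp [ih, pow_succ', mul_assoc]
    · rw [Multiset.map_cons, Multiset.prod_cons, ih, Multiset.count_cons_of_ne (Ne.symm h),
        Multiset.card_cons, Nat.succ_sub this, if_neg h, pow_succ', mul_left_comm]

theorem evalOne_ite (a b : S) (x : ℕ) (w : SGWord) :
    evalOne (fun n => if n = x then a else b) w =
      (a : WithOne S) ^ w.letters.count x * (b : WithOne S) ^ (w.letters.card - w.letters.count x) := by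
  rw [evalOne_eq_prod, ← prod_map_ite]
  congr 2
  ext n
  split_ifs <;> rfl

theorem evalOne_ite_sq (a : S) (x : ℕ) (w : SGWord) :
    evalOne (fun n => if n = x then a * a else a) w =
      (a : WithOne S) ^ (w.letters.card + w.letters.count x) := by
  rw [evalOne_ite, WithOne.coe_mul, ← pow_two, ← pow_mul, ← pow_add]
  congr 1
  have := w.letters.count_le_card x
  omega

theorem exists_coe_pow (a : S) {n : ℕ} (hn : 1 ≤ n) : ∃ b : S, (b : WithOne S) = (a : WithOne S) ^ n := by
  induction n, hn using Nat.le_induction with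
  | base => exact ⟨a, by simp⟩
  | succ n hn ih =>
    obtain ⟨b, hb⟩ := ih
    exact ⟨b * a, by rw [WithOne.coe_mul, hb, pow_succ]⟩

/-- `z` absorbs every element of `S`; such a `z` is necessarily the zero of `S`. -/
def Annihilates (z : WithOne S) : Prop := ∀ s : S, z * s = z

theorem Annihilates.mul_eq {z : WithOne S} (h : Annihilates z) (r : WithOne S) : z * r = z := by
  induction r with
  | one => simp
  | coe s => exact h s

theorem Annihilates.mul {z : WithOne S} (h : Annihilates z) (r : WithOne S) : Annihilates (z * r) := by
  rwa [h.mul_eq]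

theorem Annihilates.of_dvd {z r : WithOne S} (h : Annihilates z) (hr : z ∣ r) : Annihilates r := by
  obtain ⟨c, rfl⟩ := hr
  exact h.mul c

theorem Annihilates.pow_le {a : WithOne S} {m n : ℕ} (h : Annihilates (a ^ m)) (hmn : m ≤ n) :
    Annihilates (a ^ n) :=
  h.of_dvd (pow_dvd_pow a hmn)

theorem Annihilates.eq {z w : WithOne S} (hz : Annihilates z) (hw : Annihilates w) : z = w := by
  rw [← hz.mul_eq w, mul_comm, hw.mul_eq]

theorem evalOne_update_of_notMem {w : SGWord} {x : ℕ} (hx : x ∉ w.letters) (f : ℕ → S) (a : S) :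
    evalOne (Function.update f x a) w = evalOne f w := by
  rw [evalOne_eq_prod, evalOne_eq_prod]
  congr 1
  refine Multiset.map_congr rfl fun n hn => ?_
  rw [Function.update_of_ne (by rintro rfl; exact hx hn)]

theorem dvd_evalOne {w : SGWord} {x : ℕ} (hx : x ∈ w.letters) (f : ℕ → S) :
    (f x : WithOne S) ∣ evalOne f w := by
  rw [evalOne_eq_prod]
  exact Multiset.dvd_prod (Multiset.mem_map_of_mem (fun n => (f n : WithOne S)) hx)

end Eval

/-! ### Theories and models -/

namespace ComVariety

variable {V W : ComVariety}

theorem mem_theory_iff {u v : SGWord} : (u, v) ∈ V.theory ↔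
    ∀ S ∈ modelsOf V.theory, ∀ f : ℕ → S.carrier, evalOne f u = evalOne f v := by
  constructor
  · intro h S hS
    exact (satisfies_iff u v).1 (hS _ h)
  · intro h
    rw [← V.closed]
    exact fun S hS => (satisfies_iff u v).2 (h S hS)

theorem le_comVar_iff {E : Set SGId} : V ≤ comVar E ↔ E ⊆ V.theory := by
  constructor
  · exact fun h => (subset_theoryOfClass_modelsOf E).trans h
  · intro h
    change theoryOfClass (modelsOf E) ⊆ V.theory
    rw [← V.closed]
    exact theoryOfClass_antitone (modelsOf_antitone h)

theorem symm_mem {u v : SGWord} (h : (u, v) ∈ V.theory) : (v, u) ∈ V.theory :=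
  mem_theory_iff.2 fun S hS f => (mem_theory_iff.1 h S hS f).symm

theorem trans_mem {u v w : SGWord} (h : (u, v) ∈ V.theory) (h' : (v, w) ∈ V.theory) :
    (u, w) ∈ V.theory :=
  mem_theory_iff.2 fun S hS f => (mem_theory_iff.1 h S hS f).trans (mem_theory_iff.1 h' S hS f)

theorem mem_of_letters_eq {u v : SGWord} (h : u.letters = v.letters) : (u, v) ∈ V.theory :=
  mem_theory_iff.2 fun _ _ f => evalOne_congr f h

theorem commId_mem : commId ∈ V.theory := mem_of_letters_eq (by simp [add_comm])

/-- The word `w` is equal to zero in the variety `V`. -/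
def IsZeroWord (V : ComVariety) (w : SGWord) : Prop :=
  ∀ S ∈ modelsOf V.theory, ∀ f : ℕ → S.carrier, Annihilates (evalOne f w)

theorem zeroId_subset_iff {w : SGWord} {n : ℕ} (hn : n ∉ w.letters) :
    zeroId w n ⊆ V.theory ↔ V.IsZeroWord w := by
  constructor
  · intro h S hS f s
    have := mem_theory_iff.1 (h (Set.mem_insert _ _)) S hS (Function.update f n s)
    simpa [evalOne_update_of_notMem hn] using this
  · rintro h i (rfl | rfl)
    · exact mem_theory_iff.2 fun S hS f => by simpa using h S hS f (f n)
    · exact mem_theory_iff.2 fun S hS f => by simpa [mul_comm] using h S hS f (f n)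

/-- The variety generated by a single semigroup. -/
def generated (S : ComSG) : ComVariety where
  theory := theoryOfClass {S}
  closed := subset_antisymm (theoryOfClass_antitone fun T hT i hi => by
    rw [Set.mem_singleton_iff.1 hT]; exact hi S rfl) (subset_theoryOfClass_modelsOf _)

theorem mem_generated_theory {S : ComSG} {i : SGId} :
    i ∈ (generated S).theory ↔ SGSatisfies S.carrier i := by
  simp [generated, theoryOfClass]

theorem generated_le {S : ComSG} (hS : S ∈ modelsOf V.theory) : generated S ≤ V :=
  fun i hi => mem_generated_theory.2 (hS i hi)

end ComVariety

open ComVariety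

theorem IsChainVariety.satisfies_or {V : ComVariety} (hV : IsChainVariety V) {S T : ComSG}
    (hS : S ∈ modelsOf V.theory) (hT : T ∈ modelsOf V.theory) (i j : SGId)
    (hi : SGSatisfies S.carrier i) (hj : SGSatisfies T.carrier j) :
    SGSatisfies T.carrier i ∨ SGSatisfies S.carrier j := by
  rcases hV _ _ (generated_le hS) (generated_le hT) with h | h
  · exact Or.inr (mem_generated_theory.1 (h (mem_generated_theory.2 hj)))
  · exact Or.inl (mem_generated_theory.1 (h (mem_generated_theory.2 hi)))

theorem IsChainVariety.mono {V W : ComVariety} (hV : IsChainVariety V) (h : W ≤ V) :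
    IsChainVariety W :=
  fun W₁ W₂ h₁ h₂ => hV W₁ W₂ (h₁.trans h) (h₂.trans h)


/-! ### Words equal to zero -/

namespace ComVariety

variable {V W : ComVariety}

theorem IsZeroWord.congr {u v : SGWord} (hu : V.IsZeroWord u) (h : (u, v) ∈ V.theory) :
    V.IsZeroWord v := by
  intro S hS f
  rw [← mem_theory_iff.1 h S hS f]
  exact hu S hS f

theorem IsZeroWord.mem_theory {u v : SGWord} (hu : V.IsZeroWord u) (hv : V.IsZeroWord v) :
    (u, v) ∈ V.theory :=
  mem_theory_iff.2 fun S hS f => (hu S hS f).eq (hv S hS f)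

theorem IsZeroWord.of_map_le {u w : SGWord} (hu : V.IsZeroWord u) (g : ℕ → ℕ)
    (h : u.letters.map g ≤ w.letters) : V.IsZeroWord w := by
  intro S hS f
  refine (hu S hS (f ∘ g)).of_dvd ?_
  rw [evalOne_eq_prod, evalOne_eq_prod]
  have := Multiset.prod_dvd_prod_of_le (Multiset.map_le_map (f := fun n => (f n : WithOne S.carrier)) h)
  rwa [Multiset.map_map] at this

theorem IsZeroWord.of_not_nodup {w : SGWord} (h : V.IsZeroWord (wpow (ltr 0) 2))
    (hw : ¬ w.letters.Nodup) : V.IsZeroWord w := by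
  simp only [Multiset.nodup_iff_ne_cons_cons, not_forall, not_not] at hw
  obtain ⟨x, t, ht⟩ := hw
  refine h.of_map_le (fun _ => x) ?_
  rw [ht, letters_wpow _ one_le_two]
  simp [two_nsmul, ← Multiset.singleton_add, ← add_assoc]

theorem IsZeroWord.of_chainWord {k : ℕ} (hk : 1 ≤ k) {w : SGWord}
    (h : V.IsZeroWord (chainWord k)) (hw : k ≤ w.letters.card) : V.IsZeroWord w := by
  obtain ⟨L, hL⟩ := Quot.exists_rep w.letters
  replace hL : (L : Multiset ℕ) = w.letters := hL
  refine h.of_map_le (fun n => L.getD n 0) ?_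
  rw [letters_chainWord hk, ← hL]
  rw [← hL, Multiset.coe_card] at hw
  have : (List.range k).map (fun n => L.getD n 0) = L.take k := by
    apply List.ext_getElem
    · simp [hw]
    · intro i h1 h2
      simp only [List.length_map, List.length_range] at h1
      simp [List.getElem?_eq_getElem (h1.trans_le hw)]
  rw [Multiset.range, Multiset.map_coe, this]
  exact (List.take_sublist k L).subperm

theorem IsZeroWord.chainWord_card {w : SGWord} (h : V.IsZeroWord w) (hw : w.letters.Nodup) :
    V.IsZeroWord (chainWord w.letters.card) := by
  obtain ⟨L, hL⟩ := Quot.exists_rep w.letters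
  replace hL : (L : Multiset ℕ) = w.letters := hL
  refine h.of_map_le (fun n => L.idxOf n) ?_
  rw [letters_chainWord w.card_letters_pos, Multiset.le_iff_subset]
  · intro i hi
    obtain ⟨n, hn, rfl⟩ := Multiset.mem_map.1 hi
    rw [← hL] at hn ⊢
    simpa using List.idxOf_lt_length_of_mem hn
  · refine Multiset.Nodup.map_on (fun x hx y hy hxy => ?_) hw
    rw [← hL] at hx
    exact (List.idxOf_inj hx).1 hxy

/-- Every member of the variety has a zero. -/
def HasZeros (V : ComVariety) : Prop :=
  ∀ S ∈ modelsOf V.theory, ∃ z : S.carrier, Annihilates (z : WithOne S.carrier)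

theorem IsZeroWord.hasZeros {w : SGWord} (h : V.IsZeroWord w) : V.HasZeros := by
  intro S hS
  exact ⟨_, h S hS fun _ => Classical.arbitrary _⟩

theorem HasZeros.isZeroWord (hV : V.HasZeros) {u v : SGWord} (h : (u, v) ∈ V.theory) {x : ℕ}
    (hu : x ∈ u.letters) (hv : x ∉ v.letters) : V.IsZeroWord v := by
  intro S hS f
  obtain ⟨z, hz⟩ := hV S hS
  rw [← evalOne_update_of_notMem hv f z, ← mem_theory_iff.1 h S hS]
  exact hz.of_dvd (by simpa using dvd_evalOne hu (Function.update f x z))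

theorem HasZeros.isZeroWord_of_not_iff (hV : V.HasZeros) {u v : SGWord} (h : (u, v) ∈ V.theory)
    {x : ℕ} (hx : ¬ (x ∈ u.letters ↔ x ∈ v.letters)) : V.IsZeroWord u := by
  by_cases hu : x ∈ u.letters
  · exact (hV.isZeroWord h hu fun hv => hx (by simp [hu, hv])).congr (symm_mem h)
  · exact hV.isZeroWord (symm_mem h) (by tauto) hu

/-! ### Subvarieties of `N_ω` -/

theorem one_notMem_letters_sq : 1 ∉ letters (wpow (ltr 0) 2) := by
  simp [letters_wpow _ one_le_two, two_nsmul]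

theorem le_Nomegavar_iff : V ≤ Nomegavar ↔ V.IsZeroWord (wpow (ltr 0) 2) := by
  rw [Nomegavar, le_comVar_iff, Set.union_subset_iff, Set.singleton_subset_iff,
    zeroId_subset_iff one_notMem_letters_sq, and_iff_right commId_mem]

theorem le_Nvar_iff {k : ℕ} (hk : 1 ≤ k) :
    V ≤ Nvar k ↔ V.IsZeroWord (wpow (ltr 0) 2) ∧ V.IsZeroWord (chainWord k) := by
  rw [Nvar, le_comVar_iff, Set.union_subset_iff, Set.union_subset_iff, Set.singleton_subset_iff,
    zeroId_subset_iff one_notMem_letters_sq, zeroId_subset_iff (by simp [letters_chainWord hk]),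
    and_iff_right commId_mem]

theorem isZeroWord_of_letters_ne (hV : V ≤ Nomegavar) {u v : SGWord} (h : (u, v) ∈ V.theory)
    (hne : u.letters ≠ v.letters) : V.IsZeroWord u := by
  have hsq := le_Nomegavar_iff.1 hV
  by_cases hu : u.letters.Nodup
  · by_cases hv : v.letters.Nodup
    · rw [Ne, Multiset.Nodup.ext hu hv, not_forall] at hne
      obtain ⟨x, hx⟩ := hne
      exact hsq.hasZeros.isZeroWord_of_not_iff h hx
    · exact (hsq.of_not_nodup hv).congr (symm_mem h)
  · exact hsq.of_not_nodup hu

theorem le_of_le_Nomegavar (hV : V ≤ Nomegavar)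
    (h : ∀ u : SGWord, V.IsZeroWord u → W.IsZeroWord u) : W ≤ V := by
  rintro ⟨u, v⟩ huv
  by_cases hne : u.letters = v.letters
  · exact mem_of_letters_eq hne
  · exact (h u (isZeroWord_of_letters_ne hV huv hne)).mem_theory
      (h v (isZeroWord_of_letters_ne hV (symm_mem huv) (Ne.symm hne)))

theorem eq_Nvar_or_eq_Nomegavar (hV : V ≤ Nomegavar) :
    (∃ k, 1 ≤ k ∧ V = Nvar k) ∨ V = Nomegavar := by
  classical
  have hsq := le_Nomegavar_iff.1 hV
  by_cases hex : ∃ k, 1 ≤ k ∧ V.IsZeroWord (chainWord k)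
  · refine Or.inl ⟨Nat.find hex, (Nat.find_spec hex).1, ?_⟩
    have hk := (Nat.find_spec hex).1
    refine le_antisymm ((le_Nvar_iff hk).2 ⟨hsq, (Nat.find_spec hex).2⟩) ?_
    refine le_of_le_Nomegavar hV fun u hu => ?_
    obtain ⟨h1, h2⟩ := (le_Nvar_iff hk).1 (le_refl (Nvar (Nat.find hex)))
    by_cases hn : u.letters.Nodup
    · exact h2.of_chainWord hk (Nat.find_min' hex ⟨u.card_letters_pos, hu.chainWord_card hn⟩)
    · exact h1.of_not_nodup hn
  · refine Or.inr (le_antisymm hV (le_of_le_Nomegavar hV fun u hu => ?_))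
    refine (le_Nomegavar_iff.1 le_rfl).of_not_nodup fun hn => hex ?_
    exact ⟨_, u.card_letters_pos, hu.chainWord_card hn⟩

theorem Nvar_le_Nomegavar {k : ℕ} (hk : 1 ≤ k) : Nvar k ≤ Nomegavar :=
  le_Nomegavar_iff.2 ((le_Nvar_iff hk).1 le_rfl).1

theorem Nvar_mono {k l : ℕ} (hk : 1 ≤ k) (h : k ≤ l) : Nvar k ≤ Nvar l := by
  obtain ⟨h1, h2⟩ := (le_Nvar_iff hk).1 le_rfl
  refine (le_Nvar_iff (hk.trans h)).2 ⟨h1, h2.of_chainWord hk ?_⟩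
  simpa [letters_chainWord (hk.trans h)] using h

theorem isChainVariety_Nomegavar : IsChainVariety Nomegavar := by
  intro W₁ W₂ h₁ h₂
  rcases eq_Nvar_or_eq_Nomegavar h₁ with ⟨k, hk, rfl⟩ | rfl
  · rcases eq_Nvar_or_eq_Nomegavar h₂ with ⟨l, hl, rfl⟩ | rfl
    · exact (le_total k l).imp (Nvar_mono hk) (Nvar_mono hl)
    · exact Or.inl h₁
  · exact Or.inr h₂

/-! ### Subvarieties of `N₃ᶜ` -/

theorem le_N3cvar_iff : V ≤ N3cvar ↔ V.IsZeroWord (ltr 0 * ltr 1 * ltr 2) := by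
  rw [N3cvar, le_comVar_iff, Set.union_subset_iff, Set.singleton_subset_iff,
    zeroId_subset_iff (by simp), and_iff_right commId_mem]

theorem IsZeroWord.of_three_le_card {w : SGWord} (h : V.IsZeroWord (ltr 0 * ltr 1 * ltr 2))
    (hw : 3 ≤ w.letters.card) : V.IsZeroWord w :=
  IsZeroWord.of_chainWord (k := 3) (by norm_num) h hw

theorem annihilates_pow_of_le_N3cvar (hV : V ≤ N3cvar) {S : ComSG} (hS : S ∈ modelsOf V.theory)
    (a : S.carrier) {n : ℕ} (hn : 3 ≤ n) : Annihilates ((a : WithOne S.carrier) ^ n) := by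
  have := (le_N3cvar_iff.1 hV).of_three_le_card (w := wpow (ltr 0) 3)
    (by simp [letters_wpow]) S hS fun _ => a
  rw [evalOne_wpow _ _ (by norm_num), evalOne_ltr] at this
  exact this.pow_le hn

theorem le_Nomegavar_of_pow_eq (hV : V ≤ N3cvar) {m : ℕ} (hm : 3 ≤ m)
    (h : ∀ S ∈ modelsOf V.theory, ∀ a : S.carrier, (a : WithOne S.carrier) ^ 2 = (a : WithOne S.carrier) ^ m) :
    V ≤ Nomegavar := by
  refine le_Nomegavar_iff.2 fun S hS f => ?_
  rw [evalOne_wpow _ _ one_le_two, evalOne_ltr, h S hS]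
  exact annihilates_pow_of_le_N3cvar hV hS _ hm

theorem le_Nomegavar_of_card_le (hV : V ≤ N3cvar) {u v : SGWord} (h : (u, v) ∈ V.theory)
    (hne : u.letters ≠ v.letters) (hcard : u.letters.card ≤ v.letters.card)
    (hu : u.letters.card ≤ 2) : V ≤ Nomegavar := by
  have hval := fun S hS f => mem_theory_iff.1 h S hS f
  have hpos := u.card_letters_pos
  rcases lt_or_eq_of_le hcard with hlt | heq
  · refine le_Nomegavar_of_pow_eq hV (m := 2 + 2 * (v.letters.card - u.letters.card)) (by omega)
      fun S hS a => ?_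
    have h1 : (a : WithOne S.carrier) ^ u.letters.card = (a : WithOne S.carrier) ^ v.letters.card := by
      simpa [evalOne_const] using hval S hS fun _ => a
    obtain ⟨t, ht⟩ := Nat.exists_eq_add_of_lt hlt
    have h2 : (a : WithOne S.carrier) ^ 2 = (a : WithOne S.carrier) ^ (2 + (t + 1)) := by
      have : 2 = (2 - u.letters.card) + u.letters.card := by omega
      rw [this, pow_add, h1, ← pow_add]
      congr 1
      omega
    have h3 : v.letters.card - u.letters.card = t + 1 := by omega
    rw [h3, two_mul, ← add_assoc, pow_add, ← h2, ← pow_add, ← h2]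
  · obtain ⟨x, hx⟩ : ∃ x, u.letters.count x ≠ v.letters.count x := by
      by_contra! hc
      exact hne (Multiset.ext.2 hc)
    have h1 := u.letters.count_le_card x
    have h2 := v.letters.count_le_card x
    obtain h0 | ⟨h0, h0'⟩ : u.letters.card = 1 ∨ u.letters.card = 2 ∧ v.letters.card = 2 := by omega
    · have key : ∀ S ∈ modelsOf V.theory, ∀ a b : S.carrier, (a : WithOne S.carrier) = b := by
        intro S hS a b
        rcases Nat.lt_or_ge (u.letters.count x) 1 with h | h
        · have := hval S hS fun n => if n = x then b else a
          simpa [evalOne_ite, ← heq, h0, show u.letters.count x = 0 by omega,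
            show v.letters.count x = 1 by omega] using this
        · have := hval S hS fun n => if n = x then a else b
          simpa [evalOne_ite, ← heq, h0, show u.letters.count x = 1 by omega,
            show v.letters.count x = 0 by omega] using this
      refine le_Nomegavar_iff.2 fun S hS f s => ?_
      exact key S hS _ _
    · have e1 : ∀ S ∈ modelsOf V.theory, ∀ a : S.carrier,
          (a : WithOne S.carrier) ^ (2 + u.letters.count x) = (a : WithOne S.carrier) ^ (2 + v.letters.count x) := by
        intro S hS a
        have := hval S hS fun n => if n = x then a * a else a
        simpa [evalOne_ite_sq, h0, h0'] using this
      have e2 : ∀ S ∈ modelsOf V.theory, ∀ a : S.carrier,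
          (a : WithOne S.carrier) ^ (4 - u.letters.count x) = (a : WithOne S.carrier) ^ (4 - v.letters.count x) := by
        intro S hS a
        have := hval S hS fun n => if n = x then a else a * a
        rw [evalOne_ite, evalOne_ite, h0, h0', WithOne.coe_mul, ← pow_two, ← pow_mul, ← pow_mul,
          ← pow_add, ← pow_add] at this
        convert this using 2 <;> omega
      have : u.letters.count x = 0 ∨ v.letters.count x = 0 ∨ u.letters.count x = 2 ∨
          v.letters.count x = 2 := by omega
      rcases this with h | h | h | h
      · exact le_Nomegavar_of_pow_eq hV (m := 2 + v.letters.count x) (by omega)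
          fun S hS a => by simpa [h] using e1 S hS a
      · exact le_Nomegavar_of_pow_eq hV (m := 2 + u.letters.count x) (by omega)
          fun S hS a => by simpa [h] using (e1 S hS a).symm
      · exact le_Nomegavar_of_pow_eq hV (m := 4 - v.letters.count x) (by omega)
          fun S hS a => by simpa [h] using e2 S hS a
      · exact le_Nomegavar_of_pow_eq hV (m := 4 - u.letters.count x) (by omega)
          fun S hS a => by simpa [h] using (e2 S hS a).symm

theorem le_Nomegavar_or_eq_N3cvar (hV : V ≤ N3cvar) : V ≤ Nomegavar ∨ V = N3cvar := by
  by_cases hle : N3cvar ≤ V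
  · exact Or.inr (le_antisymm hV hle)
  · left
    obtain ⟨⟨u, v⟩, huv, hnot⟩ := Set.not_subset.1 hle
    have hne : u.letters ≠ v.letters := fun h => hnot (mem_of_letters_eq h)
    have hzero : ∀ w : SGWord, 3 ≤ w.letters.card → N3cvar.IsZeroWord w :=
      fun w hw => (le_N3cvar_iff.1 le_rfl).of_three_le_card hw
    rcases le_total u.letters.card v.letters.card with h | h
    · refine le_Nomegavar_of_card_le hV huv hne h ?_
      by_contra! hu
      exact hnot ((hzero u hu).mem_theory (hzero v (by omega)))
    · refine le_Nomegavar_of_card_le hV (symm_mem huv) hne.symm h ?_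
      by_contra! hv
      exact hnot ((hzero u (by omega)).mem_theory (hzero v hv))

theorem isChainVariety_N3cvar : IsChainVariety N3cvar := by
  intro W₁ W₂ h₁ h₂
  rcases le_Nomegavar_or_eq_N3cvar h₁ with h | rfl
  · rcases le_Nomegavar_or_eq_N3cvar h₂ with h' | rfl
    · exact isChainVariety_Nomegavar _ _ h h'
    · exact Or.inl h₁
  · exact Or.inr h₂

end ComVariety


/-! ### Cyclic groups, the two-element semilattice and the two-element null semigroup -/

/-- The cyclic group of order `d` (infinite cyclic for `d = 0`). -/
def cyclicSG (d : ℕ) : ComSG where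
  carrier := Multiplicative (ZMod d)

/-- The two-element semilattice. -/
def semilatticeSG : ComSG where
  carrier := ZMod 2

/-- The two-element null semigroup. -/
def nullSG : ComSG where
  carrier := Bool
  str :=
    { mul := fun _ _ => false
      mul_assoc := fun _ _ _ => rfl
      mul_comm := fun _ _ => rfl }
  instNonempty := ⟨true⟩

theorem prod_map_mul_congr {M : Type*} [CommMonoid M] (f : ℕ → M) (e : M) (u v : Multiset ℕ)
    (h : ∀ x, f x ^ u.count x * e = f x ^ v.count x * e) :
    (u.map f).prod * e = (v.map f).prod * e := by
  have hu : (u.map f).prod = ∏ x ∈ u.toFinset ∪ v.toFinset, f x ^ u.count x := by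
    rw [Finset.prod_multiset_map_count]
    refine Finset.prod_subset Finset.subset_union_left fun x _ hx => ?_
    rw [Multiset.count_eq_zero.2 (by simpa using hx), pow_zero]
  have hv : (v.map f).prod = ∏ x ∈ u.toFinset ∪ v.toFinset, f x ^ v.count x := by
    rw [Finset.prod_multiset_map_count]
    refine Finset.prod_subset Finset.subset_union_right fun x _ hx => ?_
    rw [Multiset.count_eq_zero.2 (by simpa using hx), pow_zero]
  rw [hu, hv]
  induction u.toFinset ∪ v.toFinset using Finset.induction_on with
  | empty => simp
  | insert x s hx ih =>
    rw [Finset.prod_insert hx, Finset.prod_insert hx, mul_assoc, ih, mul_left_comm, h,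
      mul_left_comm, mul_assoc]

theorem cyclicSG_satisfies_iff {d : ℕ} {u v : SGWord} :
    SGSatisfies (cyclicSG d).carrier (u, v) ↔
      ∀ x, u.letters.count x ≡ v.letters.count x [MOD d] := by
  have hlift : ∀ (f : ℕ → Multiplicative (ZMod d)) (w : SGWord), FreeSemigroup.lift f w =
      (w.letters.map f).prod := fun f w => lift_eq_prod f w
  change (∀ f : ℕ → Multiplicative (ZMod d), FreeSemigroup.lift f u = FreeSemigroup.lift f v) ↔ _
  simp only [hlift]
  constructor
  · intro h x
    have := h fun n => if n = x then Multiplicative.ofAdd 1 else 1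
    rw [prod_map_ite, prod_map_ite, one_pow, one_pow, mul_one, mul_one, ← ofAdd_nsmul,
      ← ofAdd_nsmul, nsmul_one, nsmul_one] at this
    exact (ZMod.natCast_eq_natCast_iff _ _ _).1 (Multiplicative.ofAdd.injective this)
  · intro h f
    have := prod_map_mul_congr f 1 u.letters v.letters fun x => ?_
    · simpa using this
    · rw [mul_one, mul_one]
      apply Multiplicative.toAdd.injective
      rw [toAdd_pow, toAdd_pow, nsmul_eq_mul, nsmul_eq_mul,
        (ZMod.natCast_eq_natCast_iff _ _ _).2 (h x)]

theorem semilatticeSG_satisfies_iff {u v : SGWord} :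
    SGSatisfies semilatticeSG.carrier (u, v) ↔ ∀ x, x ∈ u.letters ↔ x ∈ v.letters := by
  have hlift : ∀ (f : ℕ → ZMod 2) (w : SGWord), FreeSemigroup.lift f w =
      (w.letters.map f).prod := fun f w => lift_eq_prod f w
  change (∀ f : ℕ → ZMod 2, FreeSemigroup.lift f u = FreeSemigroup.lift f v) ↔ _
  simp only [hlift]
  constructor
  · intro h x
    have := h fun n => if n = x then 0 else 1
    rw [prod_map_ite, prod_map_ite, one_pow, one_pow, mul_one, mul_one] at this
    by_cases hu : x ∈ u.letters <;> by_cases hv : x ∈ v.letters <;>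
      simp_all [Multiset.count_eq_zero]
  · intro h f
    have hzero : ∀ a b : ZMod 2, (a = 0 ↔ b = 0) → a = b := by decide
    apply hzero
    rw [Multiset.prod_eq_zero_iff, Multiset.prod_eq_zero_iff]
    simp [h]

theorem nullSG_lift {w : SGWord} (hw : 2 ≤ w.letters.card) (f : ℕ → nullSG.carrier) :
    FreeSemigroup.lift f w = (false : Bool) := by
  induction w using FreeSemigroup.recOnMul with
  | ih1 n => exact absurd hw (by change ¬ 2 ≤ (letters (ltr n)).card; simp)
  | ih2 n w _ _ => rw [map_mul]; rfl

theorem nullSG_satisfies {u v : SGWord} (hu : 2 ≤ u.letters.card) (hv : 2 ≤ v.letters.card) :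
    SGSatisfies nullSG.carrier (u, v) := by
  intro f
  exact (nullSG_lift hu f).trans (nullSG_lift hv f).symm

theorem nullSG_not_satisfies {u : SGWord} {n : ℕ} (hu : 2 ≤ u.letters.card) :
    ¬ SGSatisfies nullSG.carrier (u, ltr n) := by
  intro h
  exact Bool.false_ne_true ((nullSG_lift hu _).symm.trans (h fun _ => (true : Bool)))

/-! ### Periods -/

namespace ComVariety

variable {V W : ComVariety}

/-- The variety satisfies `x ^ (s + m) = x ^ s` for some `s`. -/
def IsPeriod (V : ComVariety) (m : ℕ) : Prop :=
  ∃ s, ∀ S ∈ modelsOf V.theory, ∀ a : S.carrier,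
    (a : WithOne S.carrier) ^ (s + m) = (a : WithOne S.carrier) ^ s

theorem IsPeriod.of_add {i m : ℕ} (h : V.IsPeriod (i + m)) (hm : V.IsPeriod m) :
    V.IsPeriod i := by
  obtain ⟨s, hs⟩ := h
  obtain ⟨t, ht⟩ := hm
  refine ⟨s + t, fun S hS a => ?_⟩
  rw [show s + t + i = (s + i) + t by ring, pow_add, ← ht S hS, ← pow_add,
    show s + i + (t + m) = (s + (i + m)) + t by ring, pow_add, hs S hS, ← pow_add]

theorem IsPeriod.mul {m : ℕ} (hm : V.IsPeriod m) (k : ℕ) : V.IsPeriod (m * k) := by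
  obtain ⟨s, hs⟩ := hm
  refine ⟨s, fun S hS a => ?_⟩
  induction k with
  | zero => simp
  | succ k ih => rw [mul_add_one, ← add_assoc, pow_add, ih, ← pow_add, hs S hS]

theorem exists_isPeriod_iff_dvd (V : ComVariety) : ∃ d, ∀ m, V.IsPeriod m ↔ d ∣ m := by
  classical
  by_cases hex : ∃ m, 0 < m ∧ V.IsPeriod m
  · obtain ⟨hpos, hper⟩ := Nat.find_spec hex
    refine ⟨Nat.find hex, fun m => ⟨fun hm => ?_, ?_⟩⟩
    · have hmod : V.IsPeriod (m % Nat.find hex) :=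
        IsPeriod.of_add (by rwa [Nat.mod_add_div]) (hper.mul (m / Nat.find hex))
      by_contra hd
      exact Nat.find_min hex (Nat.mod_lt m hpos)
        ⟨Nat.pos_of_ne_zero fun h => hd (Nat.dvd_of_mod_eq_zero h), hmod⟩
    · rintro ⟨k, rfl⟩
      exact hper.mul k
  · refine ⟨0, fun m => ⟨fun hm => ?_, ?_⟩⟩
    · by_contra hd
      exact hex ⟨m, Nat.pos_of_ne_zero fun h => hd (by simp [h]), hm⟩
    · intro h
      rw [zero_dvd_iff.1 h]
      exact ⟨0, by simp⟩

theorem isPeriod_sub_count {u v : SGWord} (h : (u, v) ∈ V.theory) {x : ℕ}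
    (hle : u.letters.count x ≤ v.letters.count x) :
    V.IsPeriod (v.letters.count x - u.letters.count x) := by
  refine ⟨v.letters.card + u.letters.count x, fun S hS a => ?_⟩
  have h1 := mem_theory_iff.1 h S hS fun _ => a
  have h2 := mem_theory_iff.1 h S hS fun n => if n = x then a * a else a
  rw [evalOne_const, evalOne_const] at h1
  rw [evalOne_ite_sq, evalOne_ite_sq] at h2
  rw [add_assoc, Nat.add_sub_cancel' hle, ← h2, pow_add, pow_add, h1]

theorem count_modEq {d : ℕ} (hd : ∀ m, V.IsPeriod m ↔ d ∣ m) {u v : SGWord}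
    (h : (u, v) ∈ V.theory) (x : ℕ) : u.letters.count x ≡ v.letters.count x [MOD d] := by
  rcases le_total (u.letters.count x) (v.letters.count x) with hle | hle
  · exact (Nat.modEq_iff_dvd' hle).2 ((hd _).1 (isPeriod_sub_count h hle))
  · exact ((Nat.modEq_iff_dvd' hle).2 ((hd _).1 (isPeriod_sub_count (symm_mem h) hle))).symm

theorem cyclicSG_mem {d q : ℕ} (hd : ∀ m, V.IsPeriod m ↔ d ∣ m) (hq : q ∣ d) :
    cyclicSG q ∈ modelsOf V.theory :=
  fun _ hi => cyclicSG_satisfies_iff.2 fun x => (count_modEq hd hi x).of_dvd hq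

/-! ### Varieties omitting the null semigroup or the semilattice -/

theorem exists_pow_eq_of_nullSG_notMem (h : nullSG ∉ modelsOf V.theory) :
    ∃ n, 1 ≤ n ∧ ∀ S ∈ modelsOf V.theory, ∀ a : S.carrier,
      (a : WithOne S.carrier) ^ (1 + n) = a := by
  have key : ∀ u v : SGWord, (u, v) ∈ V.theory → u.letters ≠ v.letters → u.letters.card = 1 →
      ∃ n, 1 ≤ n ∧ ∀ S ∈ modelsOf V.theory, ∀ a : S.carrier,
        (a : WithOne S.carrier) ^ (1 + n) = a := by
    intro u v huv hne hu
    rcases Nat.lt_or_ge 1 v.letters.card with hv | hv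
    · refine ⟨v.letters.card - 1, by omega, fun S hS a => ?_⟩
      have := mem_theory_iff.1 huv S hS fun _ => a
      rw [evalOne_const, evalOne_const, hu, pow_one] at this
      rw [Nat.add_sub_cancel' hv.le, ← this]
    · have hv : v.letters.card = 1 := le_antisymm hv v.card_letters_pos
      obtain ⟨x, hx⟩ := Multiset.card_eq_one.1 hu
      obtain ⟨y, hy⟩ := Multiset.card_eq_one.1 hv
      have hxy : y ≠ x := by
        rintro rfl
        exact hne (hx.trans hy.symm)
      refine ⟨1, le_rfl, fun S hS a => ?_⟩
      have := mem_theory_iff.1 huv S hS fun n => if n = x then a * a else a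
      simpa [evalOne_eq_prod, hx, hy, hxy, pow_two] using this
  simp only [modelsOf, Set.mem_ofPred_eq, not_forall] at h
  obtain ⟨⟨u, v⟩, huv, hnot⟩ := h
  have hne : u.letters ≠ v.letters := fun h =>
    hnot ((satisfies_iff u v).2 fun f => evalOne_congr f h)
  by_cases hu : u.letters.card = 1
  · exact key u v huv hne hu
  · by_cases hv : v.letters.card = 1
    · exact key v u (symm_mem huv) hne.symm hv
    · have := u.card_letters_pos
      have := v.card_letters_pos
      exact absurd (nullSG_satisfies (by omega) (by omega)) hnot

theorem pow_eq_pow_of_semilatticeSG_notMem (h : semilatticeSG ∉ modelsOf V.theory) {N : ℕ}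
    (hN : 1 ≤ N)
    (hidem : ∀ S ∈ modelsOf V.theory, ∀ a : S.carrier,
      IsIdempotentElem ((a : WithOne S.carrier) ^ N))
    {S : ComSG} (hS : S ∈ modelsOf V.theory) (a b : S.carrier) :
    (a : WithOne S.carrier) ^ N = (b : WithOne S.carrier) ^ N := by
  have key : ∃ u v : SGWord, ∃ x, (u, v) ∈ V.theory ∧ x ∈ u.letters ∧ x ∉ v.letters := by
    simp only [modelsOf, Set.mem_ofPred_eq, not_forall] at h
    obtain ⟨⟨u, v⟩, huv, hnot⟩ := h
    rw [semilatticeSG_satisfies_iff, not_forall] at hnot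
    obtain ⟨x, hx⟩ := hnot
    by_cases hu : x ∈ u.letters
    · exact ⟨u, v, x, huv, hu, by tauto⟩
    · exact ⟨v, u, x, symm_mem huv, by tauto, hu⟩
  obtain ⟨u, v, x, huv, hu, hv⟩ := key
  have hpow : ∀ {c : WithOne S.carrier}, IsIdempotentElem c → ∀ {k : ℕ}, k ≠ 0 → c ^ k = c := by
    intro c hc k hk
    obtain ⟨k, rfl⟩ := Nat.exists_eq_succ_of_ne_zero hk
    exact hc.pow_succ_eq k
  have habs : ∀ a b : S.carrier,
      (b : WithOne S.carrier) ^ N * (a : WithOne S.carrier) ^ N = (a : WithOne S.carrier) ^ N := by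
    intro a b
    obtain ⟨c, hc⟩ := exists_coe_pow a hN
    obtain ⟨e, he⟩ := exists_coe_pow b hN
    have hci : IsIdempotentElem (c : WithOne S.carrier) := hc ▸ hidem S hS a
    have hei : IsIdempotentElem (e : WithOne S.carrier) := he ▸ hidem S hS b
    have h1 := mem_theory_iff.1 huv S hS fun n => if n = x then e else c
    rw [evalOne_ite, evalOne_ite, Multiset.count_eq_zero.2 hv, pow_zero, one_mul,
      hpow hei (Multiset.count_ne_zero.2 hu), Nat.sub_zero, hpow hci v.card_letters_pos.ne'] at h1
    rw [← hc, ← he]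
    calc (e : WithOne S.carrier) * c
        = e * (c ^ (u.letters.card - u.letters.count x) * c) := by
          rw [← pow_succ, hpow hci (Nat.succ_ne_zero _)]
      _ = c := by rw [← mul_assoc, h1, hci]
  rw [← habs a b, mul_comm, habs b a]

/-! ### Group varieties and semilattices -/

theorem le_Avar_iff {n : ℕ} (hn : 1 ≤ n) : V ≤ Avar n ↔
    ∀ S ∈ modelsOf V.theory, ∀ a b : S.carrier,
      (a : WithOne S.carrier) ^ n * (b : WithOne S.carrier) = b := by
  rw [Avar, le_comVar_iff, Set.insert_subset_iff, Set.singleton_subset_iff,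
    and_iff_left commId_mem, mem_theory_iff]
  refine forall₂_congr fun S hS => ⟨fun h a b => ?_, fun h f => ?_⟩
  · have := h fun n => if n = 0 then a else b
    simpa [evalOne_wpow _ _ hn] using this
  · simpa [evalOne_wpow _ _ hn] using h (f 0) (f 1)

theorem Avar_mono {d n : ℕ} (hn : 1 ≤ n) (h : d ∣ n) : Avar d ≤ Avar n := by
  obtain ⟨k, rfl⟩ := h
  have hd : 1 ≤ d := Nat.pos_of_mul_pos_right hn
  refine (le_Avar_iff hn).2 fun S hS a b => ?_
  have key := (le_Avar_iff hd).1 le_rfl S hS a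
  clear hn
  induction k with
  | zero => simp
  | succ k ih => rw [mul_add_one, pow_add, mul_assoc, key, ih]

theorem Avar_le {d : ℕ} (hd : 1 ≤ d)
    (h : ∀ u v : SGWord, (u, v) ∈ V.theory → ∀ x, u.letters.count x ≡ v.letters.count x [MOD d]) :
    Avar d ≤ V := by
  rintro ⟨u, v⟩ huv
  refine mem_theory_iff.2 fun S hS f => ?_
  have key := (le_Avar_iff hd).1 le_rfl S hS
  have hmod : ∀ (a b : S.carrier) (i : ℕ), (a : WithOne S.carrier) ^ i * (b : WithOne S.carrier) =
      (a : WithOne S.carrier) ^ (i % d) * b := by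
    intro a b i
    rcases Nat.eq_zero_or_pos (d * (i / d)) with h0 | h0
    · conv_lhs => rw [← Nat.mod_add_div i d, h0, add_zero]
    · have := (le_Avar_iff h0).1 (Avar_mono h0 (Nat.dvd_mul_right _ _)) S hS a b
      conv_lhs => rw [← Nat.mod_add_div i d, pow_add, mul_assoc, this]
  obtain ⟨e, he⟩ := exists_coe_pow (f 0) hd
  have hone : ∀ w, evalOne f w = evalOne f w * (e : WithOne S.carrier) := by
    intro w
    obtain ⟨b, hb⟩ := exists_coe_evalOne f w
    rw [hb, mul_comm, he, key]
  rw [hone u, hone v, evalOne_eq_prod, evalOne_eq_prod]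
  refine prod_map_mul_congr _ _ _ _ fun x => ?_
  rw [hmod, hmod _ _ (v.letters.count x), h u v huv x]

theorem eq_Avar {d : ℕ} (hd : ∀ m, V.IsPeriod m ↔ d ∣ m) (hnull : nullSG ∉ modelsOf V.theory)
    (hsl : semilatticeSG ∉ modelsOf V.theory) : 1 ≤ d ∧ V = Avar d := by
  obtain ⟨n, hn, h⟩ := exists_pow_eq_of_nullSG_notMem hnull
  have hdn : d ∣ n := (hd n).1 ⟨1, by simpa using h⟩
  have hd1 : 1 ≤ d := Nat.pos_of_dvd_of_pos hdn hn
  refine ⟨hd1, le_antisymm ?_ (Avar_le hd1 fun u v huv => count_modEq hd huv)⟩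
  have hV : V ≤ Avar n := by
    refine (le_Avar_iff hn).2 fun S hS a b => ?_
    rw [pow_eq_pow_of_semilatticeSG_notMem hsl hn (fun S hS a => ?_) hS a b, ← pow_succ, add_comm,
      h S hS]
    obtain ⟨m, rfl⟩ := Nat.exists_eq_add_of_le' hn
    rw [IsIdempotentElem, ← pow_add, show m + 1 + (m + 1) = m + (1 + (m + 1)) by ring, pow_add,
      h S hS, ← pow_succ]
  refine (le_Avar_iff hd1).2 fun S hS a b => ?_
  obtain ⟨s, hs⟩ := (hd d).2 dvd_rfl
  have key := (le_Avar_iff hn).1 hV S hS a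
  have hns : 1 ≤ n * (s + 1) := Nat.mul_pos hn s.succ_pos
  have key' := (le_Avar_iff hns).1 (hV.trans (Avar_mono hns (Nat.dvd_mul_right _ _))) S hS a b
  have hle : s ≤ n * (s + 1) := by nlinarith
  obtain ⟨t, ht⟩ := Nat.exists_eq_add_of_le hle
  rw [ht] at key'
  calc (a : WithOne S.carrier) ^ d * b = a ^ d * (a ^ (s + t) * b) := by rw [key']
    _ = a ^ (s + d) * a ^ t * b := by rw [← mul_assoc, ← pow_add, ← pow_add]; congr 2; ring
    _ = b := by rw [hs S hS, ← pow_add, key']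

theorem exists_eq_Avar_of_le {n : ℕ} (hn : 1 ≤ n) (h : V ≤ Avar n) : ∃ d, d ∣ n ∧ V = Avar d := by
  obtain ⟨d, hd⟩ := V.exists_isPeriod_iff_dvd
  have hmem : (wpow (ltr 0) n * ltr 1, ltr 1) ∈ V.theory := le_comVar_iff.1 h (Set.mem_insert _ _)
  have hlet : letters (wpow (ltr 0) n * ltr 1) = n • {0} + {1} := by simp [letters_wpow _ hn]
  refine ⟨d, (hd n).1 ⟨1, fun S hS a => ?_⟩, (eq_Avar hd (fun hnull => ?_) fun hsl => ?_).2⟩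
  · rw [add_comm, pow_succ, pow_one, (le_Avar_iff hn).1 h S hS]
  · exact nullSG_not_satisfies (by simpa [hlet] using hn) (hnull _ hmem)
  · have := (semilatticeSG_satisfies_iff.1 (hsl _ hmem) 0).1
      (by simp [hlet, Multiset.mem_nsmul, Nat.one_le_iff_ne_zero.1 hn])
    simp at this

theorem isChainVariety_Avar {p k : ℕ} (hp : p.Prime) : IsChainVariety (Avar (p ^ k)) := by
  intro W₁ W₂ h₁ h₂
  obtain ⟨d, hd, rfl⟩ := exists_eq_Avar_of_le (Nat.pow_pos hp.pos) h₁
  obtain ⟨e, he, rfl⟩ := exists_eq_Avar_of_le (Nat.pow_pos hp.pos) h₂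
  obtain ⟨i, -, rfl⟩ := (Nat.dvd_prime_pow hp).1 hd
  obtain ⟨j, -, rfl⟩ := (Nat.dvd_prime_pow hp).1 he
  exact (le_total i j).imp (fun h => Avar_mono (Nat.pow_pos hp.pos) (pow_dvd_pow p h))
    fun h => Avar_mono (Nat.pow_pos hp.pos) (pow_dvd_pow p h)

theorem le_SLvar_iff : V ≤ SLvar ↔ ∀ S ∈ modelsOf V.theory, ∀ a : S.carrier,
    (a : WithOne S.carrier) ^ 2 = a := by
  rw [SLvar, le_comVar_iff, Set.insert_subset_iff, Set.singleton_subset_iff,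
    and_iff_left commId_mem, mem_theory_iff]
  refine forall₂_congr fun S hS => ⟨fun h a => ?_, fun h f => ?_⟩
  · simpa [evalOne_wpow _ _ one_le_two] using h fun _ => a
  · simpa [evalOne_wpow _ _ one_le_two] using h (f 0)

theorem SLvar_le (h : semilatticeSG ∈ modelsOf V.theory) : SLvar ≤ V := by
  rintro ⟨u, v⟩ huv
  have hsupp := semilatticeSG_satisfies_iff.1 (h _ huv)
  refine mem_theory_iff.2 fun S hS f => ?_
  have hpow : ∀ (a : S.carrier) {k : ℕ}, k ≠ 0 → (a : WithOne S.carrier) ^ k = a := by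
    intro a k hk
    obtain ⟨k, rfl⟩ := Nat.exists_eq_succ_of_ne_zero hk
    have : IsIdempotentElem (a : WithOne S.carrier) := by
      rw [IsIdempotentElem, ← pow_two, le_SLvar_iff.1 le_rfl S hS]
    exact this.pow_succ_eq k
  rw [evalOne_eq_prod, evalOne_eq_prod]
  have := prod_map_mul_congr (fun n => (f n : WithOne S.carrier)) 1 u.letters v.letters fun x => ?_
  · simpa using this
  · by_cases hx : x ∈ u.letters
    · rw [hpow _ (Multiset.count_ne_zero.2 hx), hpow _ (Multiset.count_ne_zero.2 ((hsupp x).1 hx))]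
    · rw [Multiset.count_eq_zero.2 hx, Multiset.count_eq_zero.2 (mt (hsupp x).2 hx)]

theorem eq_SLvar_or_eq_Avar_one (h : V ≤ SLvar) : V = SLvar ∨ V = Avar 1 := by
  by_cases hsl : semilatticeSG ∈ modelsOf V.theory
  · exact Or.inl (le_antisymm h (SLvar_le hsl))
  · right
    have hmem : (wpow (ltr 0) 2, ltr 0) ∈ V.theory := le_comVar_iff.1 h (Set.mem_insert _ _)
    obtain ⟨d, hd⟩ := V.exists_isPeriod_iff_dvd
    have hd1 : d ∣ 1 := (hd 1).1 ⟨1, by simpa using le_SLvar_iff.1 h⟩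
    rw [Nat.dvd_one] at hd1
    subst hd1
    exact (eq_Avar hd (fun hnull => nullSG_not_satisfies (by simp [letters_wpow]) (hnull _ hmem))
      hsl).2

theorem isChainVariety_SLvar : IsChainVariety SLvar := by
  intro W₁ W₂ h₁ h₂
  rcases eq_SLvar_or_eq_Avar_one h₁ with rfl | rfl
  · exact Or.inr h₂
  · rcases eq_SLvar_or_eq_Avar_one h₂ with rfl | rfl
    · exact Or.inl h₁
    · exact Or.inl le_rfl

end ComVariety


/-! ### Rees quotients of relatively free semigroups -/

namespace ComVariety

variable {V W : ComVariety}

theorem mul_mem {u v u' v' : SGWord} (h : (u, v) ∈ V.theory) (h' : (u', v') ∈ V.theory) :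
    (u * u', v * v') ∈ V.theory := by
  refine mem_theory_iff.2 fun S hS f => ?_
  rw [evalOne_mul, evalOne_mul, mem_theory_iff.1 h S hS, mem_theory_iff.1 h' S hS]

theorem refl_mem (u : SGWord) : (u, u) ∈ V.theory := mem_of_letters_eq rfl

theorem lift_mem {u v : SGWord} (h : (u, v) ∈ V.theory) (σ : ℕ → SGWord) :
    (FreeSemigroup.lift σ u, FreeSemigroup.lift σ v) ∈ V.theory := by
  rw [← V.closed]
  intro S hS f
  have hcomp : ∀ w : SGWord, FreeSemigroup.lift f (FreeSemigroup.lift σ w) =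
      FreeSemigroup.lift (fun n => FreeSemigroup.lift f (σ n)) w := by
    intro w
    induction w using FreeSemigroup.recOnMul with
    | ih1 n => simp
    | ih2 n w h1 h2 => rw [map_mul, map_mul, map_mul, h1, h2]
  rw [hcomp, hcomp]
  exact hS _ h _

/-- The congruence on words identifying words equal in `V` and collapsing to a zero all words
equal in `V` to a member of the ideal `J` of words. -/
def reesCon (V : ComVariety) (J : SGWord → Prop) (hJ : ∀ u v, J u → J (u * v)) :
    Con SGWord where
  r u v := (u, v) ∈ V.theory ∨
    (∃ u', (u, u') ∈ V.theory ∧ J u') ∧ ∃ v', (v, v') ∈ V.theory ∧ J v'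
  iseqv :=
    { refl := fun u => Or.inl (refl_mem u)
      symm := fun h => h.imp symm_mem And.symm
      trans := by
        rintro u v w (h | ⟨hu, v', hv, hJv⟩) (h' | ⟨⟨v'', hv', hJv'⟩, hw⟩)
        · exact Or.inl (trans_mem h h')
        · exact Or.inr ⟨⟨v'', trans_mem h hv', hJv'⟩, hw⟩
        · exact Or.inr ⟨hu, v', trans_mem (symm_mem h') hv, hJv⟩
        · exact Or.inr ⟨hu, hw⟩ }
  mul' := by
    have hl : ∀ {w x : SGWord}, (∃ w', (w, w') ∈ V.theory ∧ J w') →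
        ∃ w', (w * x, w') ∈ V.theory ∧ J w' :=
      fun {w x} ⟨w', hw, hJw⟩ => ⟨w' * x, mul_mem hw (refl_mem x), hJ _ _ hJw⟩
    have hr : ∀ {w x : SGWord}, (∃ w', (w, w') ∈ V.theory ∧ J w') →
        ∃ w', (x * w, w') ∈ V.theory ∧ J w' :=
      fun {w x} ⟨w', hw, hJw⟩ => ⟨w' * x,
        trans_mem (mem_of_letters_eq (by simp [add_comm])) (mul_mem hw (refl_mem x)), hJ _ _ hJw⟩
    rintro u v u' v' (h | ⟨hu, hv⟩) (h' | ⟨hu', hv'⟩)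
    · exact Or.inl (mul_mem h h')
    · exact Or.inr ⟨hr hu', hr hv'⟩
    · exact Or.inr ⟨hl hu, hl hv⟩
    · exact Or.inr ⟨hl hu, hl hv⟩

variable {J : SGWord → Prop} {hJ : ∀ u v, J u → J (u * v)}

/-- The quotient of the `V`-free semigroup by the ideal generated by the words in `J`. -/
def reesSG (V : ComVariety) (J : SGWord → Prop) (hJ : ∀ u v, J u → J (u * v)) : ComSG where
  carrier := (reesCon V J hJ).Quotient
  str :=
    { (inferInstance : Semigroup (reesCon V J hJ).Quotient) with
      mul_comm := by
        intro a b
        induction a, b using Con.induction_on₂ with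
        | _ u v =>
          rw [← Con.coe_mul, ← Con.coe_mul, Con.eq]
          exact Or.inl (mem_of_letters_eq (by simp [add_comm])) }
  instNonempty := ⟨((ltr 0 : SGWord) : (reesCon V J hJ).Quotient)⟩

theorem lift_coe (σ : ℕ → SGWord) (w : SGWord) :
    FreeSemigroup.lift (fun n => (σ n : (reesCon V J hJ).Quotient)) w =
      (FreeSemigroup.lift σ w : SGWord) := by
  induction w using FreeSemigroup.recOnMul with
  | ih1 n => simp
  | ih2 n w h1 h2 => rw [map_mul, map_mul, h1, h2, Con.coe_mul]

theorem reesSG_satisfies_iff {u v : SGWord} : SGSatisfies (reesSG V J hJ).carrier (u, v) ↔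
    ∀ σ : ℕ → SGWord, reesCon V J hJ (FreeSemigroup.lift σ u) (FreeSemigroup.lift σ v) := by
  constructor
  · intro h σ
    have := h fun n => (σ n : (reesCon V J hJ).Quotient)
    exact (Con.eq _).1 (((lift_coe σ u).symm.trans this).trans (lift_coe σ v))
  · intro h f
    obtain ⟨σ, rfl⟩ : ∃ σ : ℕ → SGWord, (fun n => (σ n : (reesCon V J hJ).Quotient)) = f := by
      choose σ hσ using fun n => Quot.exists_rep (f n)
      exact ⟨σ, funext hσ⟩
    exact ((lift_coe σ u).trans ((Con.eq _).2 (h σ))).trans (lift_coe σ v).symm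

theorem reesSG_mem : reesSG V J hJ ∈ modelsOf V.theory :=
  fun _ hi => reesSG_satisfies_iff.2 fun σ => Or.inl (lift_mem hi σ)

/-- If every substitution instance of `w` lies in `J`, then the Rees quotient satisfies `w = 0`. -/
theorem reesSG_satisfies_zero {w : SGWord} (h : ∀ σ : ℕ → SGWord, J (FreeSemigroup.lift σ w))
    (n : ℕ) : SGSatisfies (reesSG V J hJ).carrier (w * ltr n, w) := by
  refine reesSG_satisfies_iff.2 fun σ => Or.inr ⟨⟨_, refl_mem _, ?_⟩, _, refl_mem _, h σ⟩
  rw [map_mul]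
  exact hJ _ _ (h σ)

theorem isZeroWord_or_of_reesSG {w : SGWord} {n : ℕ} (hn : n ∉ w.letters)
    (h : SGSatisfies (reesSG V J hJ).carrier (w * ltr n, w)) :
    V.IsZeroWord w ∨ ∃ w', (w, w') ∈ V.theory ∧ J w' := by
  have hid : ∀ u : SGWord, FreeSemigroup.lift ltr u = u := by
    intro u
    induction u using FreeSemigroup.recOnMul with
    | ih1 n => rfl
    | ih2 n u h1 h2 => rw [map_mul, h1, h2]
  have := reesSG_satisfies_iff.1 h ltr
  rw [hid, hid] at this
  rcases this with h | ⟨-, h⟩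
  · left
    refine (zeroId_subset_iff hn).1 ?_
    rintro i (rfl | rfl)
    · exact h
    · exact trans_mem (mem_of_letters_eq (by simp [add_comm])) h
  · exact Or.inr h

/-! ### Nil-varieties -/

theorem isZeroWord_of_letters_lt {s : ℕ}
    (hnil : ∀ S ∈ modelsOf V.theory, ∀ a : S.carrier, Annihilates ((a : WithOne S.carrier) ^ s))
    {u v : SGWord} (h : (u, v) ∈ V.theory) (hlt : u.letters < v.letters) : V.IsZeroWord u := by
  intro S hS f
  obtain ⟨t, ht⟩ := Multiset.le_iff_exists_add.1 hlt.le
  obtain ⟨x, hx⟩ : ∃ x, x ∈ t := by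
    refine Multiset.exists_mem_of_ne_zero fun h0 => hlt.ne ?_
    rw [ht, h0, add_zero]
  have h1 : evalOne f u = evalOne f u * (t.map fun n => (f n : WithOne S.carrier)).prod := by
    conv_lhs => rw [mem_theory_iff.1 h S hS, evalOne_eq_prod, ht, Multiset.map_add,
      Multiset.prod_add, ← evalOne_eq_prod]
  have h2 : ∀ k : ℕ, evalOne f u =
      evalOne f u * (t.map fun n => (f n : WithOne S.carrier)).prod ^ k := by
    intro k
    induction k with
    | zero => simp
    | succ k ih => rw [pow_succ, ← mul_assoc, ← ih, ← h1]
  rw [h2 s]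
  refine ((hnil S hS (f x)).of_dvd (pow_dvd_pow_of_dvd ?_ s)).of_dvd (Dvd.intro_left _ rfl)
  exact Multiset.dvd_prod (Multiset.mem_map_of_mem (fun n => (f n : WithOne S.carrier)) hx)

theorem exists_nil {s : ℕ}
    (hs : ∀ S ∈ modelsOf V.theory, ∀ a : S.carrier,
      (a : WithOne S.carrier) ^ (s + 1) = (a : WithOne S.carrier) ^ s)
    (hsl : semilatticeSG ∉ modelsOf V.theory) :
    ∃ N, 1 ≤ N ∧ ∀ S ∈ modelsOf V.theory, ∀ a : S.carrier,
      Annihilates ((a : WithOne S.carrier) ^ N) := by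
  have hpow : ∀ S ∈ modelsOf V.theory, ∀ (a : S.carrier) (t : ℕ),
      (a : WithOne S.carrier) ^ (s + t) = (a : WithOne S.carrier) ^ s := by
    intro S hS a t
    induction t with
    | zero => simp
    | succ t ih => rw [show s + (t + 1) = (s + 1) + t by ring, pow_add, hs S hS, ← pow_add, ih]
  refine ⟨s + 1, Nat.succ_pos _, fun S hS a b => ?_⟩
  rw [pow_eq_pow_of_semilatticeSG_notMem hsl (Nat.succ_pos s) (fun S hS a => ?_) hS a b,
    ← pow_succ, Nat.succ_eq_add_one, add_assoc, hpow S hS, hpow S hS]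
  rw [IsIdempotentElem, ← pow_add, Nat.succ_eq_add_one, add_assoc, hpow S hS, hpow S hS]

theorem le_N3cvar_or_le_Nomegavar {s : ℕ} (hV : IsChainVariety V) (hs : 1 ≤ s)
    (hnil : ∀ S ∈ modelsOf V.theory, ∀ a : S.carrier, Annihilates ((a : WithOne S.carrier) ^ s)) :
    V ≤ N3cvar ∨ V ≤ Nomegavar := by
  have hz : V.HasZeros := by
    intro S hS
    obtain ⟨b, hb⟩ := exists_coe_pow (Classical.arbitrary S.carrier) hs
    exact ⟨b, hb ▸ hnil S hS _⟩
  have h1 : ∀ u v : SGWord, ¬ u.letters.Nodup → ¬ (u * v).letters.Nodup := fun u v hu h =>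
    hu (Multiset.nodup_of_le (by simp) h)
  have h2 : ∀ u v : SGWord, 3 ≤ u.letters.card → 3 ≤ (u * v).letters.card := fun u v hu => by
    rw [letters_mul, Multiset.card_add]
    omega
  have hsq : ∀ σ : ℕ → SGWord, ¬ (FreeSemigroup.lift σ (wpow (ltr 0) 2)).letters.Nodup := by
    intro σ h
    change (FreeSemigroup.lift σ (ltr 0 * ltr 0)).letters.Nodup at h
    rw [map_mul, letters_mul, Multiset.nodup_add] at h
    exact Multiset.disjoint_left.1 h.2.2 (Multiset.mem_cons_self _ _) (Multiset.mem_cons_self _ _)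
  have hprod : ∀ σ : ℕ → SGWord,
      3 ≤ (FreeSemigroup.lift σ (ltr 0 * ltr 1 * ltr 2)).letters.card := by
    intro σ
    rw [map_mul, map_mul, letters_mul, letters_mul, Multiset.card_add, Multiset.card_add]
    have := card_letters_pos (FreeSemigroup.lift σ (ltr 0))
    have := card_letters_pos (FreeSemigroup.lift σ (ltr 1))
    have := card_letters_pos (FreeSemigroup.lift σ (ltr 2))
    omega
  rcases hV.satisfies_or (reesSG_mem (V := V) (J := fun w => ¬ w.letters.Nodup) (hJ := h1))
    (reesSG_mem (V := V) (J := fun w => 3 ≤ w.letters.card) (hJ := h2))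
    (wpow (ltr 0) 2 * ltr 1, wpow (ltr 0) 2)
    (ltr 0 * ltr 1 * ltr 2 * ltr 3, ltr 0 * ltr 1 * ltr 2)
    (reesSG_satisfies_zero hsq 1) (reesSG_satisfies_zero hprod 3) with h | h
  · right
    rw [le_Nomegavar_iff]
    rcases isZeroWord_or_of_reesSG one_notMem_letters_sq h with h | ⟨w, hw, hcard⟩
    · exact h
    · by_cases hx : ∀ x, x ∈ letters (wpow (ltr 0) 2) ↔ x ∈ w.letters
      · refine isZeroWord_of_letters_lt hnil hw ?_
        have hrep : w.letters = Multiset.replicate w.letters.card 0 :=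
          Multiset.eq_replicate_card.2 fun b hb => by
            simpa [letters_wpow, Multiset.mem_nsmul] using (hx b).2 hb
        rw [hrep, letters_wpow _ one_le_two, letters_ltr, Multiset.nsmul_singleton]
        refine lt_of_le_of_ne ((Multiset.replicate_le_replicate 0).2 (by omega)) fun h => ?_
        have := congrArg Multiset.card h
        simp only [Multiset.card_replicate] at this
        omega
      · obtain ⟨x, hx⟩ := not_forall.1 hx
        exact hz.isZeroWord_of_not_iff hw hx
  · left
    rw [le_N3cvar_iff]
    rcases isZeroWord_or_of_reesSG (by simp) h with h | ⟨w, hw, hnd⟩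
    · exact h
    · by_cases hx : ∀ x, x ∈ letters (ltr 0 * ltr 1 * ltr 2) ↔ x ∈ w.letters
      · refine isZeroWord_of_letters_lt hnil hw ?_
        have hnodup : (letters (ltr 0 * ltr 1 * ltr 2)).Nodup := by
          simp only [letters_mul, letters_ltr]
          decide
        refine lt_of_le_of_ne ((Multiset.le_iff_subset hnodup).2 fun x => (hx x).1) fun h => ?_
        exact hnd (h ▸ hnodup)
      · obtain ⟨x, hx⟩ := not_forall.1 hx
        exact hz.isZeroWord_of_not_iff hw hx

/-! ### Incomparable atoms -/

theorem cyclicSG_satisfies_exponent {p : ℕ} (hp : 1 ≤ p) :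
    SGSatisfies (cyclicSG p).carrier (wpow (ltr 0) p * ltr 1, ltr 1) := by
  rw [cyclicSG_satisfies_iff]
  intro x
  simp [letters_wpow _ hp, Nat.ModEq, Nat.add_mod]

theorem cyclicSG_satisfies_exponent_imp {p q : ℕ} (hp : 1 ≤ p)
    (h : SGSatisfies (cyclicSG q).carrier (wpow (ltr 0) p * ltr 1, ltr 1)) : q ∣ p := by
  have := cyclicSG_satisfies_iff.1 h 0
  simpa [letters_wpow _ hp, Nat.modEq_zero_iff_dvd] using this

theorem semilatticeSG_not_satisfies_exponent {p : ℕ} (hp : 1 ≤ p) :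
    ¬ SGSatisfies semilatticeSG.carrier (wpow (ltr 0) p * ltr 1, ltr 1) := by
  intro h
  simpa [letters_wpow _ hp, Multiset.mem_nsmul, Nat.one_le_iff_ne_zero.1 hp] using
    semilatticeSG_satisfies_iff.1 h 0

theorem nullSG_not_satisfies_exponent {p : ℕ} (hp : 1 ≤ p) :
    ¬ SGSatisfies nullSG.carrier (wpow (ltr 0) p * ltr 1, ltr 1) :=
  nullSG_not_satisfies (by simpa [letters_wpow _ hp] using hp)

theorem semilatticeSG_satisfies_idempotent :
    SGSatisfies semilatticeSG.carrier (wpow (ltr 0) 2, ltr 0) := by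
  rw [semilatticeSG_satisfies_iff]
  simp [letters_wpow, Multiset.mem_nsmul]

theorem cyclicSG_not_satisfies_idempotent {p : ℕ} (hp : p ≠ 1) :
    ¬ SGSatisfies (cyclicSG p).carrier (wpow (ltr 0) 2, ltr 0) := by
  intro h
  have := cyclicSG_satisfies_iff.1 h 0
  simp only [letters_wpow _ one_le_two, letters_ltr, Multiset.count_nsmul,
    Multiset.count_singleton_self, mul_one] at this
  exact hp (Nat.dvd_one.1 ((Nat.modEq_iff_dvd' one_le_two).1 this.symm))

theorem nullSG_satisfies_products :
    SGSatisfies nullSG.carrier (ltr 0 * ltr 1, ltr 2 * ltr 2) :=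
  nullSG_satisfies (by simp) (by simp)

theorem cyclicSG_not_satisfies_products {p : ℕ} (hp : p ≠ 1) :
    ¬ SGSatisfies (cyclicSG p).carrier (ltr 0 * ltr 1, ltr 2 * ltr 2) := by
  intro h
  have := cyclicSG_satisfies_iff.1 h 0
  simp only [letters_mul, letters_ltr] at this
  exact hp (Nat.dvd_one.1 ((Nat.modEq_zero_iff_dvd).1 this))

theorem semilatticeSG_not_satisfies_products :
    ¬ SGSatisfies semilatticeSG.carrier (ltr 0 * ltr 1, ltr 2 * ltr 2) := by
  intro h
  simpa using semilatticeSG_satisfies_iff.1 h 0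

end ComVariety

namespace IsChainVariety

variable {V : ComVariety}

theorem prime_eq (hV : IsChainVariety V) {p q : ℕ} (hp : p.Prime) (hq : q.Prime)
    (hpV : cyclicSG p ∈ modelsOf V.theory) (hqV : cyclicSG q ∈ modelsOf V.theory) : p = q := by
  rcases hV.satisfies_or hpV hqV _ _ (cyclicSG_satisfies_exponent hp.one_le)
    (cyclicSG_satisfies_exponent hq.one_le) with h | h
  · exact ((Nat.prime_dvd_prime_iff_eq hq hp).1 (cyclicSG_satisfies_exponent_imp hp.one_le h)).symm
  · exact (Nat.prime_dvd_prime_iff_eq hp hq).1 (cyclicSG_satisfies_exponent_imp hq.one_le h)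

theorem semilatticeSG_notMem (hV : IsChainVariety V) {p : ℕ} (hp : p.Prime)
    (hpV : cyclicSG p ∈ modelsOf V.theory) : semilatticeSG ∉ modelsOf V.theory := by
  intro hsl
  rcases hV.satisfies_or hpV hsl _ _ (cyclicSG_satisfies_exponent hp.one_le)
    semilatticeSG_satisfies_idempotent with h | h
  · exact semilatticeSG_not_satisfies_exponent hp.one_le h
  · exact cyclicSG_not_satisfies_idempotent hp.ne_one h

theorem nullSG_notMem (hV : IsChainVariety V) {p : ℕ} (hp : p.Prime)
    (hpV : cyclicSG p ∈ modelsOf V.theory) : nullSG ∉ modelsOf V.theory := by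
  intro hnull
  rcases hV.satisfies_or hpV hnull _ _ (cyclicSG_satisfies_exponent hp.one_le)
    nullSG_satisfies_products with h | h
  · exact nullSG_not_satisfies_exponent hp.one_le h
  · exact cyclicSG_not_satisfies_products hp.ne_one h

theorem nullSG_notMem_of_semilatticeSG_mem (hV : IsChainVariety V)
    (hsl : semilatticeSG ∈ modelsOf V.theory) : nullSG ∉ modelsOf V.theory := by
  intro hnull
  rcases hV.satisfies_or hsl hnull _ _ semilatticeSG_satisfies_idempotent
    nullSG_satisfies_products with h | h
  · exact nullSG_not_satisfies (by simp [letters_wpow]) h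
  · exact semilatticeSG_not_satisfies_products h

theorem eq_Avar_of_ne_one (hV : IsChainVariety V) {d : ℕ} (hd : ∀ m, V.IsPeriod m ↔ d ∣ m)
    (hne : d ≠ 1) : ∃ p k : ℕ, p.Prime ∧ 1 ≤ k ∧ V = Avar (p ^ k) := by
  obtain ⟨p, hp, hpd⟩ := Nat.exists_prime_and_dvd hne
  have hpV := cyclicSG_mem hd hpd
  obtain ⟨hd1, hVd⟩ := eq_Avar hd (hV.nullSG_notMem hp hpV) (hV.semilatticeSG_notMem hp hpV)
  have hdp : d = p ^ d.primeFactorsList.length :=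
    Nat.eq_prime_pow_of_unique_prime_dvd (by omega)
      fun {q} hq hqd => hV.prime_eq hq hp (cyclicSG_mem hd hqd) hpV
  refine ⟨p, d.primeFactorsList.length, hp, Nat.one_le_iff_ne_zero.2 fun h0 => hne ?_, hdp ▸ hVd⟩
  rw [hdp, h0, pow_zero]

end IsChainVariety

theorem ComVariety.eq_SLvar_of_semilatticeSG_mem {V : ComVariety}
    (hper : ∀ m, V.IsPeriod m ↔ 1 ∣ m) (hsl : semilatticeSG ∈ modelsOf V.theory)
    (hnull : nullSG ∉ modelsOf V.theory) : V = SLvar := by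
  obtain ⟨n, hn, h⟩ := exists_pow_eq_of_nullSG_notMem hnull
  obtain ⟨s, hs⟩ := (hper 1).2 dvd_rfl
  refine le_antisymm (le_SLvar_iff.2 fun S hS a => ?_) (SLvar_le hsl)
  have hmul : ∀ t : ℕ, (a : WithOne S.carrier) ^ (1 + n * t) = a := by
    intro t
    induction t with
    | zero => simp
    | succ t ih => rw [mul_add_one, ← add_assoc, add_right_comm, pow_add, h S hS,
        ← pow_succ', add_comm, ih]
  obtain ⟨t, ht⟩ := Nat.exists_eq_add_of_le (show s ≤ n * s by nlinarith)
  calc (a : WithOne S.carrier) ^ 2 = a ^ (1 + n * s) * a := by rw [hmul, pow_two]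
    _ = a ^ (s + 1) * a ^ (1 + t) := by rw [← pow_succ, ← pow_add, ht]; congr 1; ring
    _ = a ^ (1 + n * s) := by rw [hs S hS, ← pow_add, ht]; congr 1; ring
    _ = a := hmul s

/-- **Lemma.** The chain varieties of commutative semigroups are exactly: the varieties
`A (p^k)` with `p` prime and `k ≥ 1` natural, `SL`, the varieties `N k` for natural
`k ≥ 1`, `N_ω`, and `N₃ᶜ`. -/
theorem chain_varieties_of_Com (V : ComVariety) :
    IsChainVariety V ↔
      (∃ p k : ℕ, p.Prime ∧ 1 ≤ k ∧ V = Avar (p ^ k)) ∨ V = SLvar ∨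
      (∃ k : ℕ, 1 ≤ k ∧ V = Nvar k) ∨ V = Nomegavar ∨ V = N3cvar := by
  constructor
  · intro hV
    obtain ⟨d, hd⟩ := V.exists_isPeriod_iff_dvd
    by_cases hne : d = 1
    · subst hne
      by_cases hsl : semilatticeSG ∈ modelsOf V.theory
      · exact Or.inr (Or.inl (eq_SLvar_of_semilatticeSG_mem hd hsl
          (hV.nullSG_notMem_of_semilatticeSG_mem hsl)))
      · obtain ⟨s, hs⟩ := (hd 1).2 dvd_rfl
        obtain ⟨N, hN, hnil⟩ := exists_nil hs hsl
        have hω : V ≤ Nomegavar →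
            (∃ k : ℕ, 1 ≤ k ∧ V = Nvar k) ∨ V = Nomegavar ∨ V = N3cvar :=
          fun h => (eq_Nvar_or_eq_Nomegavar h).imp_right Or.inl
        refine Or.inr (Or.inr ?_)
        rcases le_N3cvar_or_le_Nomegavar hV hN hnil with h | h
        · rcases le_Nomegavar_or_eq_N3cvar h with h | h
          · exact hω h
          · exact Or.inr (Or.inr h)
        · exact hω h
    · exact Or.inl (hV.eq_Avar_of_ne_one hd hne)
  · rintro (⟨p, k, hp, -, rfl⟩ | rfl | ⟨k, hk, rfl⟩ | rfl | rfl)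
    · exact isChainVariety_Avar hp
    · exact isChainVariety_SLvar
    · exact isChainVariety_Nomegavar.mono (Nvar_le_Nomegavar hk)
    · exact isChainVariety_Nomegavar
    · exact isChainVariety_N3cvar
end

section
/- If a periodic semigroup variety V is generated by a commutative monoid, then V = G ∨ C_m for some Abelian periodic group variety G and some integer m ≥ 0. -/
open FirstOrder

/-! ### Letter counts and identities of commutative monoids -/

/-- The number of occurrences of each letter in a word. -/
noncomputable def letterCount (w : SGWord) : ℕ →₀ ℕ :=
  Multiplicative.toAdd
    (FreeSemigroup.lift (fun n => Multiplicative.ofAdd (Finsupp.single n 1)) w)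

theorem letterCount_of (n : ℕ) : letterCount (FreeSemigroup.of n) = Finsupp.single n 1 := by
  simp [letterCount]

theorem letterCount_mul (u v : SGWord) :
    letterCount (u * v) = letterCount u + letterCount v := by
  simp [letterCount]

theorem lift_eq_prod_letterCount {M : Type} [CommMonoid M] (f : ℕ → M) (w : SGWord) :
    FreeSemigroup.lift f w = (letterCount w).prod fun n k => f n ^ k := by
  induction w using FreeSemigroup.recOnMul with
  | ih1 n => simp [letterCount_of]
  | ih2 u v hu hv =>
    rw [map_mul, hu, hv, letterCount_mul,
      Finsupp.prod_add_index' (fun _ => pow_zero _) (fun _ _ _ => pow_add _ _ _)]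

theorem sgSatisfies_iff_letterCount {M : Type} [CommMonoid M] (i : SGId) :
    SGSatisfies M i ↔ ∀ n, ∀ x : M, x ^ letterCount i.1 n = x ^ letterCount i.2 n := by
  constructor
  · intro h n x
    have key : ∀ w : SGWord,
        FreeSemigroup.lift (Pi.mulSingle n x : ℕ → M) w = x ^ letterCount w n := by
      intro w
      rw [lift_eq_prod_letterCount, Finsupp.prod_eq_single n]
      · simp
      · intro k _ hk
        simp [Pi.mulSingle_eq_of_ne hk]
      · simp
    rw [← key, ← key]
    exact h _
  · intro h f
    rw [lift_eq_prod_letterCount, lift_eq_prod_letterCount,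
      Finsupp.prod_of_support_subset _
        (Finset.subset_union_left (s₂ := (letterCount i.2).support)) _ (fun _ _ => pow_zero _),
      Finsupp.prod_of_support_subset _
        (Finset.subset_union_right (s₁ := (letterCount i.1).support)) _ (fun _ _ => pow_zero _)]
    exact Finset.prod_congr rfl fun n _ => h n (f n)

theorem lift_wpow {S : Type} [Semigroup S] (f : ℕ → S) (w : SGWord) (n : ℕ) :
    FreeSemigroup.lift f (wpow w n) = spow (FreeSemigroup.lift f w) n := by
  induction n using wpow.induct with
  | case1 => rfl
  | case2 => rfl
  | case3 n ih => rw [wpow, map_mul, ih, spow]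

theorem spow_succ_eq_pow {M : Type} [Monoid M] (a : M) (n : ℕ) :
    spow a (n + 1) = a ^ (n + 1) := by
  induction n with
  | zero => simp [spow]
  | succ n ih => rw [spow, ih, pow_succ _ (n + 1)]

theorem coe_spow {S : Type} [Semigroup S] (a : S) (n : ℕ) :
    ((spow a (n + 1) : S) : WithOne S) = (a : WithOne S) ^ (n + 1) := by
  induction n with
  | zero => simp [spow]
  | succ n ih => rw [spow, WithOne.coe_mul, ih, pow_succ _ (n + 1)]

theorem coe_lift {S : Type} [Semigroup S] (f : ℕ → S) (w : SGWord) :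
    ((FreeSemigroup.lift f w : S) : WithOne S) =
      FreeSemigroup.lift (fun n => (f n : WithOne S)) w := by
  induction w using FreeSemigroup.recOnMul with
  | ih1 n => simp
  | ih2 u v hu hv => rw [map_mul, WithOne.coe_mul, hu, hv, map_mul]

theorem SGSatisfies.of_withOne {S : Type} [Semigroup S] {i : SGId}
    (h : SGSatisfies (WithOne S) i) : SGSatisfies S i := by
  intro f
  apply WithOne.coe_injective
  rw [coe_lift, coe_lift]
  exact h _

theorem sgSatisfies_commId (S : Type) [CommSemigroup S] : SGSatisfies S commId := by
  intro f
  simp [commId, mul_comm]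

theorem SGSatisfies.pi {S ι : Type} [Semigroup S] {i : SGId} (h : SGSatisfies S i) :
    SGSatisfies (ι → S) i := by
  intro f
  funext k
  have key : ∀ w : SGWord,
      FreeSemigroup.lift f w k = FreeSemigroup.lift (fun n => f n k) w := by
    intro w
    induction w using FreeSemigroup.recOnMul with
    | ih1 n => simp
    | ih2 u v hu hv => rw [map_mul, Pi.mul_apply, hu, hv, map_mul]
  rw [key, key]
  exact h _

/-! ### Theories of the varieties involved -/

theorem ComVariety.theory_sup (V W : ComVariety) : (V ⊔ W).theory = V.theory ∩ W.theory := by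
  apply subset_antisymm
  · exact Set.subset_inter (le_sup_left : V ≤ V ⊔ W) (le_sup_right : W ≤ V ⊔ W)
  · let U : ComVariety :=
      { theory := V.theory ∩ W.theory
        closed := by
          apply subset_antisymm
          · refine Set.subset_inter ?_ ?_
            · exact (theoryOfClass_antitone (modelsOf_antitone Set.inter_subset_left)).trans
                V.closed.subset
            · exact (theoryOfClass_antitone (modelsOf_antitone Set.inter_subset_right)).trans
                W.closed.subset
          · exact subset_theoryOfClass_modelsOf _ }
    exact (sup_le (Set.inter_subset_left : V ≤ U) (Set.inter_subset_right : W ≤ U) : V ⊔ W ≤ U)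

/-- The variety generated by a commutative semigroup. -/
def varietyOf (S : ComSG) : ComVariety where
  theory := theoryOfClass {S}
  closed := by
    apply subset_antisymm
    · refine theoryOfClass_antitone ?_
      rintro _ rfl i hi
      exact hi _ rfl
    · exact subset_theoryOfClass_modelsOf _

theorem mem_theory_varietyOf {S : ComSG} {i : SGId} :
    i ∈ (varietyOf S).theory ↔ SGSatisfies S.carrier i :=
  ⟨fun h => h S rfl, by rintro h _ rfl; exact h⟩

theorem mem_theory_of_generatedBy {M : Type} [CommMonoid M] {V : ComVariety}
    (h : GeneratedBy M inferInstance V) (i : SGId) : i ∈ V.theory ↔ SGSatisfies M i := by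
  refine ⟨h.1 i, fun hi => ?_⟩
  have hle : V ≤ varietyOf ⟨M⟩ := h.2 fun j hj => mem_theory_varietyOf.1 hj
  exact hle (mem_theory_varietyOf.2 hi)

/-- The congruence on `(ℕ, +)` identifying all numbers that are at least `m`. -/
def truncCon (m : ℕ) : AddCon ℕ where
  r a b := min a m = min b m
  iseqv := ⟨fun _ => rfl, fun h => h.symm, fun h h' => h.trans h'⟩
  add' := by intro a b c d (h : min a m = min b m) (h' : min c m = min d m); show _ = _; omega

theorem truncCon_pow_eq (m : ℕ) (x : Multiplicative (truncCon m).Quotient) :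
    x ^ m = x ^ (m + 1) := by
  induction x using Multiplicative.rec with | ofAdd x => ?_
  induction x using AddCon.induction_on with | H k => ?_
  refine congrArg Multiplicative.ofAdd
    ((AddCon.eq _).2 (show min (m • k) m = min ((m + 1) • k) m from ?_))
  rcases k.eq_zero_or_pos with rfl | hk
  · simp
  · rw [min_eq_right, min_eq_right] <;> simp only [smul_eq_mul] <;> nlinarith

theorem pow_eq_pow_of_min_eq {M : Type} [Monoid M] {m : ℕ} {x : M} (hx : x ^ m = x ^ (m + 1))
    {a b : ℕ} (h : min a m = min b m) : x ^ a = x ^ b := by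
  have key : ∀ k, x ^ (m + k) = x ^ m := by
    intro k
    induction k with
    | zero => rfl
    | succ k ih => rw [← add_assoc, pow_succ, ih, ← pow_succ, ← hx]
  rcases lt_or_ge a m with ha | ha
  · rw [show a = b by omega]
  · obtain ⟨c, rfl⟩ := Nat.exists_eq_add_of_le ha
    obtain ⟨d, rfl⟩ := Nat.exists_eq_add_of_le (show m ≤ b by omega)
    rw [key, key]

theorem mem_theory_Cvar (m : ℕ) (i : SGId) : i ∈ (Cvar m).theory ↔
    ∀ n, min (letterCount i.1 n) m = min (letterCount i.2 n) m := by
  cases m with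
  | zero =>
    simp only [Nat.min_zero, implies_true, iff_true]
    intro S hS f
    simpa [ltr] using hS _ rfl fun n =>
      if n = 0 then FreeSemigroup.lift f i.1 else FreeSemigroup.lift f i.2
  | succ m =>
    constructor
    · intro h n
      have hS : (⟨Multiplicative (truncCon (m + 1)).Quotient⟩ : ComSG) ∈ modelsOf
          {(wpow (ltr 0) (m + 1), wpow (ltr 0) (m + 2)), commId} := by
        rintro j (rfl | rfl)
        · intro f
          rw [lift_wpow, lift_wpow, spow_succ_eq_pow, spow_succ_eq_pow, truncCon_pow_eq]
        · exact sgSatisfies_commId _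
      have h1 : ((letterCount i.1 n • 1 : ℕ) : (truncCon (m + 1)).Quotient) =
          ((letterCount i.2 n • 1 : ℕ) : (truncCon (m + 1)).Quotient) :=
        (sgSatisfies_iff_letterCount i).1 (h _ hS) n
          (Multiplicative.ofAdd ((1 : ℕ) : (truncCon (m + 1)).Quotient))
      have h2 : min (letterCount i.1 n • 1) (m + 1) = min (letterCount i.2 n • 1) (m + 1) :=
        (AddCon.eq _).1 h1
      simpa using h2
    · intro h S hS
      refine SGSatisfies.of_withOne ((sgSatisfies_iff_letterCount i).2 fun n x => ?_)
      refine pow_eq_pow_of_min_eq ?_ (h n)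
      cases x with
      | one => simp
      | coe a =>
        have h1 := hS _ (Or.inl rfl) fun _ => a
        rw [lift_wpow, lift_wpow] at h1
        rw [← coe_spow, ← coe_spow]
        simpa [ltr] using h1

theorem mem_theory_varietyOf_zmod (p : ℕ) (i : SGId) :
    i ∈ (varietyOf ⟨Multiplicative (ZMod p)⟩).theory ↔
      ∀ n, letterCount i.1 n ≡ letterCount i.2 n [MOD p] := by
  rw [mem_theory_varietyOf, sgSatisfies_iff_letterCount]
  refine forall_congr' fun n => ?_
  rw [← ZMod.natCast_eq_natCast_iff]
  constructor
  · intro h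
    have h1 : letterCount i.1 n • (1 : ZMod p) = letterCount i.2 n • (1 : ZMod p) :=
      h (Multiplicative.ofAdd (1 : ZMod p))
    simpa using h1
  · intro h x
    have h1 (y : ZMod p) : letterCount i.1 n • y = letterCount i.2 n • y := by
      rw [nsmul_eq_mul, nsmul_eq_mul, h]
    exact h1 (Multiplicative.toAdd x)

theorem letterCount_wpow_succ (w : SGWord) (n : ℕ) :
    letterCount (wpow w (n + 1)) = (n + 1) • letterCount w := by
  induction n with
  | zero => simp [wpow]
  | succ n ih => rw [wpow, letterCount_mul, ih, succ_nsmul _ (n + 1)]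

theorem spow_mul_eq_of_mem_modelsOf_zmod {p : ℕ} {S : ComSG}
    (hS : S ∈ modelsOf (varietyOf ⟨Multiplicative (ZMod (p + 1))⟩).theory) (a b : S.carrier) :
    spow a (p + 1) * b = b := by
  have h := hS (wpow (ltr 0) (p + 1) * ltr 1, ltr 1)
    ((mem_theory_varietyOf_zmod _ _).2 fun n => by
      rw [letterCount_mul, letterCount_wpow_succ]
      simp [Nat.ModEq])
    fun n => if n = 0 then a else b
  simpa [lift_wpow, ltr] using h

theorem isGroupVariety_varietyOf_zmod (p : ℕ) :
    IsGroupVariety (varietyOf ⟨Multiplicative (ZMod (p + 1))⟩) := by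
  intro S hS
  have key := spow_mul_eq_of_mem_modelsOf_zmod hS
  obtain ⟨a₀⟩ := S.instNonempty
  have hconst : ∀ a, spow a (p + 1) = spow a₀ (p + 1) := fun a => by
    rw [← key a₀ (spow a (p + 1)), mul_comm, key]
  refine ⟨spow a₀ (p + 1), fun a => ⟨key _ _, by rw [mul_comm, key]⟩, fun a => ?_⟩
  suffices h : ∃ b, a * b = spow a₀ (p + 1) by
    obtain ⟨b, hb⟩ := h
    exact ⟨b, hb, by rw [mul_comm, hb]⟩
  cases p with
  | zero => exact ⟨a₀, key a a₀⟩
  | succ p => exact ⟨spow a (p + 1), by rw [← hconst a, spow, mul_comm]⟩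

theorem isPeriodicVariety_varietyOf_zmod (p : ℕ) :
    IsPeriodicVariety (varietyOf ⟨Multiplicative (ZMod (p + 1))⟩) := fun S hS a =>
  ⟨1, p + 2, le_rfl, by omega, (spow_mul_eq_of_mem_modelsOf_zmod hS a a).symm⟩

theorem exists_pow_eq_pow_of_isPeriodicVariety {M : Type} [CommMonoid M] {V : ComVariety}
    (hper : IsPeriodicVariety V) (hM : ∀ i ∈ V.theory, SGSatisfies M i) :
    ∃ m p : ℕ, ∀ x : M, x ^ m = x ^ (m + (p + 1)) := by
  obtain ⟨a, b, ha, hab, h⟩ := hper ⟨M → M⟩ (fun i hi => (hM i hi).pi) id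
  obtain ⟨m, rfl⟩ := Nat.exists_eq_add_of_le' ha
  obtain ⟨p, rfl⟩ := Nat.exists_eq_add_of_lt hab
  refine ⟨m + 1, p, fun x => ?_⟩
  rw [show m + 1 + p + 1 = (m + 1 + p) + 1 from rfl, spow_succ_eq_pow, spow_succ_eq_pow] at h
  exact congrFun h x

theorem pow_add_mul_eq {M : Type} [Monoid M] {m p : ℕ} {x : M} (hx : x ^ m = x ^ (m + p))
    {a : ℕ} (ha : m ≤ a) (k : ℕ) : x ^ (a + p * k) = x ^ a := by
  obtain ⟨c, rfl⟩ := Nat.exists_eq_add_of_le ha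
  induction k with
  | zero => rfl
  | succ k ih =>
    rw [show m + c + p * (k + 1) = (m + p) + (c + p * k) by ring, pow_add, ← hx, ← pow_add,
      ← add_assoc, ih]

/-- The congruence `{(a, b) ∣ xᵃ = xᵇ for all x}` on `ℕ` of a periodic monoid is determined by
an index and a period. -/
theorem exists_index_period {M : Type} [Monoid M]
    (h : ∃ m p : ℕ, ∀ x : M, x ^ m = x ^ (m + (p + 1))) :
    ∃ m p : ℕ, ∀ a b : ℕ, (∀ x : M, x ^ a = x ^ b) ↔
      a ≡ b [MOD p + 1] ∧ min a m = min b m := by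
  classical
  let m := Nat.find h
  have hm : ∃ p : ℕ, ∀ x : M, x ^ m = x ^ (m + (p + 1)) := Nat.find_spec h
  let p := Nat.find hm
  have hp : ∀ x : M, x ^ m = x ^ (m + (p + 1)) := Nat.find_spec hm
  refine ⟨m, p, fun a b => ?_⟩
  wlog hab : a ≤ b generalizing a b
  · rw [Nat.ModEq.comm, eq_comm (a := min a m), ← this b a (by omega)]
    exact forall_congr' fun x => eq_comm
  obtain ⟨d, rfl⟩ := Nat.exists_eq_add_of_le hab
  have hmod : a ≡ a + d [MOD p + 1] ↔ p + 1 ∣ d := by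
    rw [Nat.modEq_iff_dvd' hab, Nat.add_sub_cancel_left]
  rw [hmod]
  constructor
  · intro hx
    rcases d.eq_zero_or_pos with rfl | hd
    · simp
    have hma : m ≤ a :=
      Nat.find_min' h ⟨d - 1, by rw [Nat.sub_add_cancel hd]; exact hx⟩
    refine ⟨?_, by omega⟩
    have hle : a ≤ m + (p + 1) * a := by nlinarith
    obtain ⟨t, ht⟩ := Nat.exists_eq_add_of_le hle
    have hshift : ∀ x : M, x ^ m = x ^ (m + d % (p + 1)) := fun x => calc
      x ^ m = x ^ (a + t) := by rw [← ht, pow_add_mul_eq (hp x) le_rfl]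
      _ = x ^ (a + d + t) := by rw [pow_add, hx, ← pow_add]
      _ = x ^ (m + d + (p + 1) * a) := by congr 1; omega
      _ = x ^ (m + d) := pow_add_mul_eq (hp x) (by omega) _
      _ = x ^ (m + d % (p + 1) + (p + 1) * (d / (p + 1))) := by
        rw [add_assoc, Nat.mod_add_div]
      _ = x ^ (m + d % (p + 1)) := pow_add_mul_eq (hp x) (by omega) _
    by_contra hnd
    have hpos : 0 < d % (p + 1) := Nat.pos_of_ne_zero fun h0 => hnd (Nat.dvd_of_mod_eq_zero h0)
    have hmin : p ≤ d % (p + 1) - 1 :=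
      Nat.find_min' hm (by rw [Nat.sub_add_cancel hpos]; exact hshift)
    have hlt : d % (p + 1) < p + 1 := Nat.mod_lt d p.succ_pos
    omega
  · rintro ⟨⟨k, rfl⟩, hmin⟩ x
    rcases lt_or_ge a m with ha | ha
    · rw [show a + (p + 1) * k = a by omega]
    · exact (pow_add_mul_eq (hp x) ha k).symm

/-- **Lemma.** If a periodic semigroup variety `V` is generated by a commutative monoid,
then `V = G ∨ C m` for some Abelian periodic group variety `G` and some `m ≥ 0`.
(Every member of a commutative variety is commutative, so "Abelian" is automatic.) -/
theorem periodic_commutative_monoid_variety (V : ComVariety)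
    (hper : IsPeriodicVariety V)
    (hgen : ∃ (M : Type) (inst : CommMonoid M), GeneratedBy M inst.toMonoid.toSemigroup V) :
    ∃ (G : ComVariety) (m : ℕ),
      IsGroupVariety G ∧ IsPeriodicVariety G ∧ V = G ⊔ Cvar m := by
  obtain ⟨M, inst, hV⟩ := hgen
  have hM := mem_theory_of_generatedBy hV
  obtain ⟨m, p, hmp⟩ := exists_index_period
    (exists_pow_eq_pow_of_isPeriodicVariety hper fun i => (hM i).1)
  refine ⟨_, m, isGroupVariety_varietyOf_zmod p, isPeriodicVariety_varietyOf_zmod p,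
    ComVariety.ext' ?_⟩
  ext i
  rw [ComVariety.theory_sup, Set.mem_inter_iff, mem_theory_varietyOf_zmod, mem_theory_Cvar, hM,
    sgSatisfies_iff_letterCount, ← forall_and]
  exact forall_congr' fun n => hmp _ _
end
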